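/- arXiv:math/0211268 — 3 statements merged into one kernel-verified Lean document; each statement's English description precedes it below -/
import Mathlib

section
/- For all integers A, B ≥ 0 with A + B ≡ 1 (mod 2), the counting function g₂ satisfies the recursion g₂(A,B) = C((3A+B−1)/2, A)·C((A+3B−1)/2, B) + Σ g₂(a,b)·C((3A+B−3a−b)/2 − 1, A−a)·C((A+3B−a−3b)/2 − 1, B−b), where the sum ranges over all integers a, b with 0 ≤ a ≤ A, 0 ≤ b ≤ B, a + b ≡ 1 (mod 2), and a + b < A + B. -/
open Set

noncomputable section

/-- A point of the integer lattice `ℤ² ⊆ ℝ²`. -/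
def IsLatticePoint (p : ℝ × ℝ) : Prop := ∃ a b : ℤ, p = ((a : ℝ), (b : ℝ))

/-- A triangle: the convex hull of three affinely independent points of `ℝ²`. -/
def IsTriangle (Δ : Set (ℝ × ℝ)) : Prop :=
  ∃ p q r : ℝ × ℝ, AffineIndependent ℝ ![p, q, r] ∧ Δ = convexHull ℝ {p, q, r}

/-- `F` is a face of the triangle `Δ`: the empty set, a vertex, an edge,
or the whole triangle. -/
def IsFaceOf (F Δ : Set (ℝ × ℝ)) : Prop :=
  ∃ p q r : ℝ × ℝ, AffineIndependent ℝ ![p, q, r] ∧ Δ = convexHull ℝ {p, q, r} ∧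
    (F = ∅ ∨ F = {p} ∨ F = {q} ∨ F = {r} ∨
     F = segment ℝ p q ∨ F = segment ℝ q r ∨ F = segment ℝ p r ∨ F = Δ)

/-- The determinant of the two edge vectors of the triangle `pqr` emanating
from `p`; its absolute value is twice the Euclidean area of the triangle. -/
def triDet (p q r : ℝ × ℝ) : ℝ :=
  (q.1 - p.1) * (r.2 - p.2) - (q.2 - p.2) * (r.1 - p.1)

/-- A unimodular triangle: a lattice triangle of area `1/2`. -/
def IsUnimodularTriangle (Δ : Set (ℝ × ℝ)) : Prop :=
  ∃ p q r : ℝ × ℝ, IsLatticePoint p ∧ IsLatticePoint q ∧ IsLatticePoint r ∧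
    AffineIndependent ℝ ![p, q, r] ∧ Δ = convexHull ℝ {p, q, r} ∧
    |triDet p q r| = 1

/-- `T` is a unimodular triangulation of the region `P`. -/
def IsUnimodularTriangulation (P : Set (ℝ × ℝ)) (T : Set (Set (ℝ × ℝ))) : Prop :=
  T.Finite ∧ (∀ Δ ∈ T, IsUnimodularTriangle Δ ∧ Δ ⊆ P) ∧ ⋃₀ T = P ∧
  ∀ Δ₁ ∈ T, ∀ Δ₂ ∈ T, IsFaceOf (Δ₁ ∩ Δ₂) Δ₁ ∧ IsFaceOf (Δ₁ ∩ Δ₂) Δ₂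

/-- The number of unimodular triangulations of the region `P`. -/
def numTriangulations (P : Set (ℝ × ℝ)) : ℕ :=
  Set.ncard {T | IsUnimodularTriangulation P T}

/-- `f m n` is the number of unimodular triangulations of `[0,m] × [0,n]`. -/
def f (m n : ℕ) : ℕ :=
  numTriangulations (Set.Icc (0, 0) ((m : ℝ), (n : ℝ)))

/-- `Δ₂` lies above `Δ₁` (written `Δ₁ ≺ Δ₂`). -/
def LiesAbove (Δ₁ Δ₂ : Set (ℝ × ℝ)) : Prop :=
  ∃ x y₁ y₂ : ℝ, (x, y₁) ∈ Δ₁ \ Δ₂ ∧ (x, y₂) ∈ Δ₂ \ Δ₁ ∧ y₁ < y₂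

/-- `g₂ A B` is the number of unimodular triangulations of the width-2 trapezoid
`conv{(0,0), (2,0), (0,A), (2,B)}`. -/
def g₂ (A B : ℕ) : ℕ :=
  numTriangulations
    (convexHull ℝ {((0 : ℝ), (0 : ℝ)), (2, 0), (0, (A : ℝ)), (2, (B : ℝ))})

/-- Codes for the unimodular triangles in the strip `0 ≤ x ≤ 2`. -/
inductive Tile
  /-- The triangle `(0, i), (0, i + 1), (1, c)`. -/
  | leftOuter (i c : ℤ)
  /-- The triangle `(0, i), (1, c), (1, c + 1)`. -/
  | leftInner (i c : ℤ)
  /-- The triangle `(2, j), (2, j + 1), (1, c)`. -/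
  | rightOuter (j c : ℤ)
  /-- The triangle `(2, j), (1, c), (1, c + 1)`. -/
  | rightInner (j c : ℤ)
  /-- The triangle `(0, i), (1, c), (2, 2 * c - 1 - i)`, with its wide edge at the bottom. -/
  | peak (i c : ℤ)
  /-- The triangle `(0, i), (1, c), (2, 2 * c + 1 - i)`, with its wide edge at the top. -/
  | valley (i c : ℤ)

namespace Tile

/-- The reflection of a tile in the line `x = 1`. -/
def mirror : Tile → Tile
  | leftOuter i c => rightOuter i c
  | leftInner i c => rightInner i c
  | rightOuter j c => leftOuter j c
  | rightInner j c => leftInner j c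
  | peak i c => peak (2 * c - 1 - i) c
  | valley i c => valley (2 * c + 1 - i) c

@[simp]
theorem mirror_mirror (t : Tile) : t.mirror.mirror = t := by
  cases t <;> simp [mirror]

/-- `t.Left p q p' q'` means that the part of `t` in `0 ≤ x ≤ 1` is a nondegenerate region, bounded
below by the segment from `(0, p)` to `(1, q / 2)` and above by the segment from `(0, p')` to
`(1, q' / 2)`. -/
def Left : Tile → ℤ → ℤ → ℤ → ℤ → Prop
  | leftOuter i c, p, q, p', q' => p = i ∧ q = 2 * c ∧ p' = i + 1 ∧ q' = 2 * c
  | leftInner i c, p, q, p', q' => p = i ∧ q = 2 * c ∧ p' = i ∧ q' = 2 * c + 2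
  | rightOuter _ _, _, _, _, _ => False
  | rightInner _ _, _, _, _, _ => False
  | peak i c, p, q, p', q' => p = i ∧ q = 2 * c - 1 ∧ p' = i ∧ q' = 2 * c
  | valley i c, p, q, p', q' => p = i ∧ q = 2 * c ∧ p' = i ∧ q' = 2 * c + 1

theorem Left.le {t : Tile} {p q p' q' : ℤ} (h : t.Left p q p' q') :
    p ≤ p' ∧ q ≤ q' ∧ p + q < p' + q' := by
  cases t <;> simp only [Left] at h <;> omega

theorem Left.unique {t : Tile} {p q p' q' r s r' s' : ℤ} (h : t.Left p q p' q')
    (h' : t.Left r s r' s') : p = r ∧ q = s ∧ p' = r' ∧ q' = s' := by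
  cases t <;> simp only [Left] at h h' <;> omega

theorem Left.tile_eq {t t' : Tile} {p q p' q' : ℤ} (h : t.Left p q p' q')
    (h' : t'.Left p q p' q') : t = t' := by
  cases t <;> cases t' <;> simp only [Left, reduceCtorEq, leftOuter.injEq, leftInner.injEq,
    peak.injEq, valley.injEq] at h h' ⊢ <;> omega

theorem exists_left_or_right (t : Tile) :
    (∃ p q p' q', t.Left p q p' q') ∨ ∃ p q p' q', t.mirror.Left p q p' q' := by
  cases t <;> simp [Left, mirror]

/-- The parts of `t` and `t'` in `0 ≤ x ≤ 1` do not overlap. -/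
def LeftOrdered (t t' : Tile) : Prop :=
  ∀ p q p' q' r s r' s', t.Left p q p' q' → t'.Left r s r' s' →
    (p' ≤ r ∧ q' ≤ s) ∨ (r' ≤ p ∧ s' ≤ q)

/-- The part of `t` in `0 ≤ x ≤ 1` lies above `y = 0` and below the segment from `(0, a)` to
`(1, m / 2)`. -/
def LeftFits (a m : ℤ) (t : Tile) : Prop :=
  ∀ p q p' q', t.Left p q p' q' → 0 ≤ p ∧ 0 ≤ q ∧ p' ≤ a ∧ q' ≤ m

end Tile

open Tile

/-- The height at abscissa `x` of the line through `(0, p)` and `(1, q / 2)`. -/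
def height (p q : ℤ) (x : ℝ) : ℝ := p * (1 - x) + q / 2 * x

/-- The tiles of `S` tile the part in `0 ≤ x ≤ 1` of the region below the segment from `(0, a)` to
`(1, m / 2)`. -/
structure FillsLeft (a m : ℤ) (S : Set Tile) : Prop where
  fits : ∀ t ∈ S, t.LeftFits a m
  ordered : ∀ t ∈ S, ∀ t' ∈ S, t ≠ t' → t.LeftOrdered t'
  cover : ∀ x y : ℝ, 0 < x → x < 1 → 0 < y → y < height a m x →
    ∃ t ∈ S, ∃ p q p' q', t.Left p q p' q' ∧ height p q x ≤ y ∧ y ≤ height p' q' x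

/-- The tiles of `S` tile the region below the segments from `(0, a)` to `(1, m / 2)` and from
`(1, n / 2)` to `(2, b)`. -/
def Fills (a m n b : ℤ) (S : Set Tile) : Prop :=
  FillsLeft a m S ∧ FillsLeft b n (mirror ⁻¹' S)

/-- The number of tilings of the region below the segments from `(0, a)` to `(1, m / 2)` and from
`(1, n / 2)` to `(2, b)`. -/
def numFillings (a m n b : ℤ) : ℕ := {S | Fills a m n b S}.ncard

theorem height_le_height {p q r s : ℤ} {x : ℝ} (hx : 0 ≤ x) (hx' : x ≤ 1) (hp : p ≤ r)
    (hq : q ≤ s) : height p q x ≤ height r s x := by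
  have hp' : (p : ℝ) ≤ r := by exact_mod_cast hp
  have hq' : (q : ℝ) ≤ s := by exact_mod_cast hq
  have : 0 ≤ 1 - x := by linarith
  unfold height
  gcongr

theorem height_lt_height {p q r s : ℤ} {x : ℝ} (hx : 0 < x) (hx' : x < 1) (hp : p ≤ r)
    (hq : q ≤ s) (h : p + q < r + s) : height p q x < height r s x := by
  have hp' : (p : ℝ) ≤ r := by exact_mod_cast hp
  have hq' : (q : ℝ) ≤ s := by exact_mod_cast hq
  unfold height
  rcases hp.lt_or_eq with hlt | rfl
  · have : (p : ℝ) < r := by exact_mod_cast hlt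
    have : (p : ℝ) * (1 - x) < r * (1 - x) := mul_lt_mul_of_pos_right this (by linarith)
    nlinarith
  · have : (q : ℝ) < s := by exact_mod_cast (by omega : q < s)
    nlinarith

theorem height_zero (x : ℝ) : height 0 0 x = 0 := by simp [height]

theorem height_nonneg {p q : ℤ} {x : ℝ} (hx : 0 ≤ x) (hx' : x ≤ 1) (hp : 0 ≤ p) (hq : 0 ≤ q) :
    0 ≤ height p q x := by
  simpa [height_zero] using height_le_height hx hx' hp hq

theorem Tile.LeftOrdered.symm {t t' : Tile} (h : t.LeftOrdered t') : t'.LeftOrdered t :=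
  fun p q p' q' r s r' s' h₁ h₂ => (h r s r' s' p q p' q' h₂ h₁).symm

namespace FillsLeft

variable {a m : ℤ} {S : Set Tile} {t : Tile}

/-- Some tile lies directly below the top segment. -/
theorem exists_top (h : FillsLeft a m S) (ha : 0 ≤ a) (hm : 0 ≤ m) (hpos : 0 < a + m) :
    ∃ t ∈ S, ∃ p q, t.Left p q a m := by
  have hr : (1 : ℝ) ≤ 2 * a + m := by exact_mod_cast (by omega : 1 ≤ 2 * a + m)
  obtain ⟨t, ht, p, q, p', q', hL, -, hy⟩ := h.cover (1 / 2) ((2 * a + m - 1 / 2) / 4)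
    (by norm_num) (by norm_num) (by linarith) (by unfold height; linarith)
  obtain ⟨-, -, hp, hq⟩ := h.fits t ht _ _ _ _ hL
  have : (2 * a + m : ℝ) - 1 < 2 * p' + q' := by unfold height at hy; linarith
  have : 2 * a + m - 1 < 2 * p' + q' := by exact_mod_cast this
  obtain rfl : p' = a := by omega
  obtain rfl : q' = m := by omega
  exact ⟨t, ht, p, q, hL⟩

theorem insert_iff_of_no_left (hno : ∀ p q p' q', ¬ t.Left p q p' q') :
    FillsLeft a m (insert t S) ↔ FillsLeft a m S := by
  constructor
  · intro h
    refine ⟨fun u hu => h.fits u (Or.inr hu), fun u hu v hv => h.ordered u (Or.inr hu) v (Or.inr hv),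
      fun x y hx hx' hy hy' => ?_⟩
    obtain ⟨u, rfl | hu, p, q, p', q', hL, h'⟩ := h.cover x y hx hx' hy hy'
    · exact (hno _ _ _ _ hL).elim
    · exact ⟨u, hu, p, q, p', q', hL, h'⟩
  · intro h
    refine ⟨?_, ?_, fun x y hx hx' hy hy' => ?_⟩
    · rintro u (rfl | hu)
      · exact fun p q p' q' hL => (hno _ _ _ _ hL).elim
      · exact h.fits u hu
    · rintro u (rfl | hu) v (rfl | hv) huv
      · exact (huv rfl).elim
      · exact fun _ _ _ _ _ _ _ _ hL => (hno _ _ _ _ hL).elim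
      · exact fun _ _ _ _ _ _ _ _ _ hL => (hno _ _ _ _ hL).elim
      · exact h.ordered u hu v hv huv
    · obtain ⟨u, hu, h'⟩ := h.cover x y hx hx' hy hy'
      exact ⟨u, Or.inr hu, h'⟩

/-- Removing a tile directly below the top segment. -/
theorem insert_iff {p q : ℤ} (ht : t ∉ S) (hL : t.Left p q a m) (hp : 0 ≤ p) (hq : 0 ≤ q) :
    FillsLeft a m (insert t S) ↔ FillsLeft p q S := by
  have hle := hL.le
  constructor
  · intro h
    refine ⟨?_, fun u hu v hv => h.ordered u (Or.inr hu) v (Or.inr hv),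
      fun x y hx hx' hy hy' => ?_⟩
    · intro u hu p₁ q₁ p₂ q₂ hu'
      have h₁ := h.fits u (Or.inr hu) _ _ _ _ hu'
      have h₂ := h.ordered u (Or.inr hu) t (Or.inl rfl) (by rintro rfl; exact ht hu)
        _ _ _ _ _ _ _ _ hu' hL
      have := hu'.le
      omega
    · have hlt := height_lt_height hx hx' hle.1 hle.2.1 hle.2.2
      obtain ⟨u, rfl | hu, p₁, q₁, p₂, q₂, hu', h₁, h₂⟩ := h.cover x y hx hx' hy (hy'.trans hlt)
      · obtain ⟨rfl, rfl, -⟩ := hu'.unique hL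
        exact (not_le.2 hy' h₁).elim
      · exact ⟨u, hu, p₁, q₁, p₂, q₂, hu', h₁, h₂⟩
  · intro h
    have key : ∀ u ∈ S, u.LeftOrdered t := by
      intro u hu p₁ q₁ p₂ q₂ r s r' s' h₁ h₂
      obtain ⟨rfl, rfl, rfl, rfl⟩ := h₂.unique hL
      have := h.fits u hu _ _ _ _ h₁
      omega
    refine ⟨?_, ?_, fun x y hx hx' hy hy' => ?_⟩
    · rintro u (rfl | hu) p₁ q₁ p₂ q₂ hu'
      · obtain ⟨rfl, rfl, rfl, rfl⟩ := hu'.unique hL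
        omega
      · have := h.fits u hu _ _ _ _ hu'
        omega
    · rintro u (rfl | hu) v (rfl | hv) huv
      · exact (huv rfl).elim
      · exact (key v hv).symm
      · exact key u hu
      · exact h.ordered u hu v hv huv
    · rcases lt_or_ge y (height p q x) with hlt | hge
      · obtain ⟨u, hu, h'⟩ := h.cover x y hx hx' hy hlt
        exact ⟨u, Or.inr hu, h'⟩
      · exact ⟨t, Or.inl rfl, p, q, a, m, hL, hge, hy'.le⟩

theorem notMem_of_top {p q p' q' : ℤ} (h : FillsLeft p q S) (hL : t.Left p q p' q') : t ∉ S := by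
  intro ht
  have := h.fits t ht _ _ _ _ hL
  have := hL.le
  omega

theorem eq_of_top (h : FillsLeft a m S) {t' : Tile} {p q r s : ℤ} (ht : t ∈ S) (ht' : t' ∈ S)
    (hL : t.Left p q a m) (hL' : t'.Left r s a m) : t = t' := by
  by_contra hne
  have := h.ordered t ht t' ht' hne _ _ _ _ _ _ _ _ hL hL'
  have := hL.le
  have := hL'.le
  omega

end FillsLeft

theorem Tile.preimage_mirror_insert (t : Tile) (S : Set Tile) :
    mirror ⁻¹' (insert t S) = insert t.mirror (mirror ⁻¹' S) := by
  ext u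
  simp only [mem_preimage, mem_insert_iff]
  refine or_congr ⟨?_, ?_⟩ Iff.rfl <;> rintro rfl <;> simp

theorem Fills.symm {a m n b : ℤ} {S : Set Tile} (h : Fills a m n b S) :
    Fills b n m a (mirror ⁻¹' S) := by
  refine ⟨h.2, ?_⟩
  have : mirror ⁻¹' (mirror ⁻¹' S) = S := by ext; simp
  rw [this]
  exact h.1

theorem numFillings_symm (a m n b : ℤ) : numFillings a m n b = numFillings b n m a := by
  have hinv : ∀ S : Set Tile, mirror ⁻¹' (mirror ⁻¹' S) = S := fun S => by ext; simp
  refine ncard_congr (fun S _ => mirror ⁻¹' S) (fun S hS => hS.symm) ?_ ?_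
  · intro S S' _ _ h
    rw [← hinv S, ← hinv S', h]
  · exact fun S hS => ⟨mirror ⁻¹' S, hS.symm, hinv S⟩

theorem finite_tiles_fit (a m n b : ℤ) :
    {t : Tile | t.LeftFits a m ∧ t.mirror.LeftFits b n}.Finite := by
  let K : Set (ℤ × ℤ) := Icc 0 a ×ˢ Icc 0 m ∪ Icc 0 b ×ˢ Icc 0 n
  have hK : K.Finite := by
    refine Finite.union ?_ ?_ <;> exact (finite_Icc _ _).prod (finite_Icc _ _)
  have hfin (f : ℤ → ℤ → Tile) : ((fun z : ℤ × ℤ => f z.1 z.2) '' K).Finite := hK.image _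
  refine ((hfin leftOuter).union <| (hfin leftInner).union <| (hfin rightOuter).union <|
    (hfin rightInner).union <| (hfin peak).union (hfin valley)).subset ?_
  rintro t ⟨h₁, h₂⟩
  cases t <;>
    first
    | have := h₁ _ _ _ _ ⟨rfl, rfl, rfl, rfl⟩
      simp [K]
      omega
    | have := h₂ _ _ _ _ ⟨rfl, rfl, rfl, rfl⟩
      simp [K]
      omega

theorem Fills.subset {a m n b : ℤ} {S : Set Tile} (h : Fills a m n b S) :
    S ⊆ {t : Tile | t.LeftFits a m ∧ t.mirror.LeftFits b n} :=
  fun t ht => ⟨h.1.fits t ht, h.2.fits _ (by simpa using ht)⟩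

theorem finite_fillings (a m n b : ℤ) : {S | Fills a m n b S}.Finite :=
  (finite_tiles_fit a m n b).finite_subsets.subset fun _ hS => hS.subset

/-- Removing one fixed tile from tilings. -/
theorem ncard_fillings_mem {a m n b a' m' n' b' : ℤ} {t : Tile} (Q Q' : Set Tile → Prop)
    (h : ∀ S, t ∉ S → (Fills a m n b (insert t S) ↔ Fills a' m' n' b' S))
    (hmem : ∀ S, Fills a' m' n' b' S → t ∉ S) (hQ : ∀ S, Q (insert t S) ↔ Q' S) :
    {S | Fills a m n b S ∧ t ∈ S ∧ Q S}.ncard = {S | Fills a' m' n' b' S ∧ Q' S}.ncard := by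
  have : {S | Fills a m n b S ∧ t ∈ S ∧ Q S} = insert t '' {S | Fills a' m' n' b' S ∧ Q' S} := by
    ext S
    constructor
    · rintro ⟨hS, ht, hQS⟩
      have hi : insert t (S \ {t}) = S := by simp [insert_eq_of_mem ht]
      refine ⟨S \ {t}, ⟨(h _ (by simp)).1 (by rwa [hi]), (hQ _).1 (by rwa [hi])⟩, hi⟩
    · rintro ⟨S', ⟨hS', hQ''⟩, rfl⟩
      exact ⟨(h _ (hmem _ hS')).2 hS', Or.inl rfl, (hQ _).2 hQ''⟩
  rw [this]
  refine InjOn.ncard_image fun S hS S' hS' heq => ?_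
  have hS₁ := hmem S hS.1
  have hS₂ := hmem S' hS'.1
  rw [← insert_sdiff_self_of_notMem hS₁, ← insert_sdiff_self_of_notMem hS₂]
  exact congrArg (· \ {t}) heq

theorem numFillings_zero : numFillings 0 0 0 0 = 1 := by
  have hempty : FillsLeft 0 0 ∅ := by
    refine ⟨by simp, by simp, fun x y _ _ hy hy' => ?_⟩
    rw [height_zero] at hy'
    exact (lt_asymm hy hy').elim
  have : {S | Fills 0 0 0 0 S} = {∅} := by
    ext S
    simp only [mem_ofPred_eq, mem_singleton_iff]
    constructor
    · intro h
      refine eq_empty_of_forall_notMem fun t ht => ?_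
      obtain ⟨h₁, h₂⟩ := h.subset ht
      rcases t.exists_left_or_right with ⟨p, q, p', q', hL⟩ | ⟨p, q, p', q', hL⟩
      · have := h₁ _ _ _ _ hL
        have := hL.le
        omega
      · have := h₂ _ _ _ _ hL
        have := hL.le
        omega
    · rintro rfl
      exact ⟨hempty, by simpa using hempty⟩
  rw [numFillings, this, ncard_singleton]

/-- Removing a top tile that only meets `0 ≤ x ≤ 1`. -/
theorem ncard_fillings_left {a m n b p q : ℤ} {t : Tile} (Q : Set Tile → Prop)
    (hL : t.Left p q a m) (hp : 0 ≤ p) (hq : 0 ≤ q)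
    (hno : ∀ p q p' q', ¬ t.mirror.Left p q p' q') (hQ : ∀ S, Q (insert t S) ↔ Q S) :
    {S | Fills a m n b S ∧ t ∈ S ∧ Q S}.ncard = {S | Fills p q n b S ∧ Q S}.ncard := by
  refine ncard_fillings_mem Q Q (fun S ht => ?_) (fun S hS => hS.1.notMem_of_top hL) hQ
  rw [Fills, Fills, preimage_mirror_insert, FillsLeft.insert_iff ht hL hp hq,
    FillsLeft.insert_iff_of_no_left hno]

/-- Removing a top tile that meets both `0 ≤ x ≤ 1` and `1 ≤ x ≤ 2`. -/
theorem ncard_fillings_wide {a m n b p q r s : ℤ} {t : Tile}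
    (hL : t.Left p q a m) (hp : 0 ≤ p) (hq : 0 ≤ q)
    (hR : t.mirror.Left r s b n) (hr : 0 ≤ r) (hs : 0 ≤ s) :
    {S | Fills a m n b S ∧ t ∈ S}.ncard = numFillings p q s r := by
  have := ncard_fillings_mem (a := a) (m := m) (n := n) (b := b) (a' := p) (m' := q) (n' := s)
    (b' := r) (t := t) (fun _ => True) (fun _ => True) (fun S ht => ?_)
    (fun S hS => hS.1.notMem_of_top hL) (fun _ => Iff.rfl)
  · simpa [numFillings] using this
  · have ht' : t.mirror ∉ mirror ⁻¹' S := by simpa using ht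
    rw [Fills, Fills, preimage_mirror_insert, FillsLeft.insert_iff ht hL hp hq,
      FillsLeft.insert_iff ht' hR hr hs]

theorem ncard_fillings_leftOuter {a c : ℤ} (n b : ℤ) (ha : 0 ≤ a) (hc : 0 ≤ c) :
    {S | Fills a (2 * c) n b S ∧ leftOuter (a - 1) c ∈ S}.ncard =
      if 1 ≤ a then numFillings (a - 1) (2 * c) n b else 0 := by
  have hL : (leftOuter (a - 1) c).Left (a - 1) (2 * c) a (2 * c) := by simp [Left]
  split_ifs with h
  · simpa [numFillings] using ncard_fillings_left (n := n) (b := b) (fun _ => True) hL (by omega)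
      (by omega) (by simp [mirror, Left]) (by simp)
  · convert ncard_empty (Set Tile)
    refine eq_empty_of_forall_notMem fun S hS => ?_
    have := hS.1.1.fits _ hS.2 _ _ _ _ hL
    omega

theorem ncard_fillings_leftInner {a c : ℤ} (n b : ℤ) (ha : 0 ≤ a) (hc : 0 ≤ c) :
    {S | Fills a (2 * c) n b S ∧ leftInner a (c - 1) ∈ S}.ncard =
      if 1 ≤ c then numFillings a (2 * (c - 1)) n b else 0 := by
  have hL : (leftInner a (c - 1)).Left a (2 * (c - 1)) a (2 * c) := by simp [Left]; ring
  split_ifs with h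
  · simpa [numFillings] using ncard_fillings_left (n := n) (b := b) (fun _ => True) hL (by omega)
      (by omega) (by simp [mirror, Left]) (by simp)
  · convert ncard_empty (Set Tile)
    refine eq_empty_of_forall_notMem fun S hS => ?_
    have := hS.1.1.fits _ hS.2 _ _ _ _ hL
    omega

/-- The tilings with a peak whose left edge is on top: the part to the right of the peak is tiled by
a forced fan. -/
theorem ncard_fillings_peak {a c b : ℤ} (ha : 0 ≤ a) (hb : 0 ≤ 2 * c - 1 - a)
    (h : 2 * c - 1 - a ≤ b) :
    {S | Fills a (2 * c) (2 * c) b S ∧ peak a c ∈ S}.ncard =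
      numFillings a (2 * c - 1) (2 * c - 1) (2 * c - 1 - a) := by
  obtain ⟨k, rfl⟩ := Int.le.dest h
  clear h
  have hpL : (peak a c).Left a (2 * c - 1) a (2 * c) := by simp [Left]
  have hpR : (peak a c).mirror.Left (2 * c - 1 - a) (2 * c - 1) (2 * c - 1 - a) (2 * c) := by
    simp [Left, mirror]
  induction k with
  | zero =>
    refine ncard_fillings_wide hpL ha (by omega) ?_ hb (by omega)
    simpa using hpR
  | succ k ih =>
    rw [← ih]
    set b := 2 * c - 1 - a + (k : ℤ) with hbdef
    have hb' : 2 * c - 1 - a + ((k + 1 : ℕ) : ℤ) = b + 1 := by push_cast; omega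
    rw [hb']
    have hrefl : ∀ b, {S | Fills a (2 * c) (2 * c) b S ∧ peak a c ∈ S}.ncard =
        {S | Fills b (2 * c) (2 * c) a S ∧ peak (2 * c - 1 - a) c ∈ S}.ncard := by
      intro b
      have hinv : ∀ S : Set Tile, mirror ⁻¹' (mirror ⁻¹' S) = S := fun S => by ext; simp
      refine ncard_congr (fun S _ => mirror ⁻¹' S) (fun S hS => ⟨hS.1.symm, ?_⟩) ?_ ?_
      · simpa [mirror] using hS.2
      · intro S S' _ _ h
        rw [← hinv S, ← hinv S', h]
      · exact fun S hS => ⟨mirror ⁻¹' S, ⟨hS.1.symm, by simpa [mirror] using hS.2⟩, hinv S⟩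
    rw [hrefl, hrefl]
    have hL : (leftOuter b c).Left b (2 * c) (b + 1) (2 * c) := by simp [Left]
    rw [← ncard_fillings_left (fun S => peak (2 * c - 1 - a) c ∈ S) hL (by omega) (by omega)
      (by simp [mirror, Left]) (by simp)]
    congr 1
    ext S
    simp only [mem_ofPred_eq]
    refine and_congr_right fun hS => ⟨fun hp => ⟨?_, hp⟩, fun h => h.2⟩
    obtain ⟨t, ht, p, q, hL'⟩ := hS.1.exists_top (by omega) (by omega) (by omega)
    have hne : t ≠ peak (2 * c - 1 - a) c := by
      rintro rfl
      simp only [Left] at hL'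
      omega
    have hord := hS.1.ordered _ ht _ hp hne _ _ _ _ _ _ _ _ hL' hpR
    cases t <;> simp only [Left] at hL'
    case leftOuter i c' =>
      obtain rfl : i = b := by omega
      obtain rfl : c' = c := by omega
      exact ht
    all_goals omega

theorem numFillings_rec {a b c d : ℤ} (ha : 0 ≤ a) (hd : 0 ≤ d) (hdc : d ≤ c)
    (hpos : 0 < a + c) :
    numFillings a (2 * c) (2 * d) b =
      (if 1 ≤ a then numFillings (a - 1) (2 * c) (2 * d) b else 0) +
      (if 1 ≤ c then numFillings a (2 * (c - 1)) (2 * d) b else 0) +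
      if d = c ∧ 0 ≤ 2 * c - 1 - a ∧ 2 * c - 1 - a ≤ b then
        numFillings a (2 * c - 1) (2 * c - 1) (2 * c - 1 - a) else 0 := by
  have hfin := finite_fillings a (2 * c) (2 * d) b
  have hO : (leftOuter (a - 1) c).Left (a - 1) (2 * c) a (2 * c) := by simp [Left]
  have hI : (leftInner a (c - 1)).Left a (2 * (c - 1)) a (2 * c) := by simp [Left]; ring
  have hpL : (peak a c).Left a (2 * c - 1) a (2 * c) := by simp [Left]
  have hpR : (peak a c).mirror.Left (2 * c - 1 - a) (2 * c - 1) (2 * c - 1 - a) (2 * c) := by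
    simp [Left, mirror]
  have hsplit : {S | Fills a (2 * c) (2 * d) b S} =
      ({S | Fills a (2 * c) (2 * d) b S ∧ leftOuter (a - 1) c ∈ S} ∪
        {S | Fills a (2 * c) (2 * d) b S ∧ leftInner a (c - 1) ∈ S}) ∪
        {S | Fills a (2 * c) (2 * d) b S ∧ peak a c ∈ S} := by
    ext S
    simp only [mem_union, mem_ofPred_eq, ← and_or_left]
    refine ⟨fun hS => ⟨hS, ?_⟩, fun h => h.1⟩
    obtain ⟨t, ht, p, q, hL⟩ := hS.1.exists_top ha (by omega) (by omega)
    cases t <;> simp only [Left] at hL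
    case leftOuter i c' =>
      obtain rfl : i = a - 1 := by omega
      obtain rfl : c' = c := by omega
      exact Or.inl (Or.inl ht)
    case leftInner i c' =>
      obtain rfl : i = a := by omega
      obtain rfl : c' = c - 1 := by omega
      exact Or.inl (Or.inr ht)
    case peak i c' =>
      obtain rfl : i = a := by omega
      obtain rfl : c' = c := by omega
      exact Or.inr ht
    omega
  have hpeak : {S | Fills a (2 * c) (2 * d) b S ∧ peak a c ∈ S}.ncard =
      if d = c ∧ 0 ≤ 2 * c - 1 - a ∧ 2 * c - 1 - a ≤ b then
        numFillings a (2 * c - 1) (2 * c - 1) (2 * c - 1 - a) else 0 := by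
    split_ifs with h
    · obtain ⟨rfl, h₁, h₂⟩ := h
      exact ncard_fillings_peak ha h₁ h₂
    · convert ncard_empty (Set Tile)
      refine eq_empty_of_forall_notMem fun S hS => h ?_
      have := hS.1.1.fits _ hS.2 _ _ _ _ hpL
      have := hS.1.2.fits (peak a c).mirror (by simpa using hS.2) _ _ _ _ hpR
      omega
  rw [← ncard_fillings_leftOuter (2 * d) b ha (by omega),
    ← ncard_fillings_leftInner (2 * d) b ha (by omega), ← hpeak, numFillings, hsplit,
    ncard_union_eq ?_ (hfin.subset (by rintro S (h | h) <;> exact h.1))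
      (hfin.subset fun S h => h.1),
    ncard_union_eq ?_ (hfin.subset fun S h => h.1) (hfin.subset fun S h => h.1)]
  · rw [disjoint_left]
    rintro S ⟨hS, h₁⟩ ⟨-, h₂⟩
    cases hS.1.eq_of_top h₁ h₂ hO hI
  · rw [disjoint_left]
    rintro S (⟨hS, h₁⟩ | ⟨hS, h₁⟩) ⟨-, h₂⟩
    · cases hS.1.eq_of_top h₁ h₂ hO hpL
    · cases hS.1.eq_of_top h₁ h₂ hI hpL

theorem numFillings_wide {a b c : ℤ} (ha : 0 ≤ a) (hb : 0 ≤ b) (hc : a + b = 2 * c + 1) :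
    numFillings a (a + b) (a + b) b = numFillings a (2 * c) (2 * c) b := by
  obtain rfl : b = 2 * c + 1 - a := by omega
  have hL : (valley a c).Left a (2 * c) a (a + (2 * c + 1 - a)) := by simp [Left]
  have hR : (valley a c).mirror.Left (2 * c + 1 - a) (2 * c) (2 * c + 1 - a)
      (a + (2 * c + 1 - a)) := by simp [Left, mirror]
  rw [← ncard_fillings_wide hL ha (by omega) hR hb (by omega), numFillings]
  congr 1
  ext S
  simp only [mem_ofPred_eq]
  refine ⟨fun hS => ⟨hS, ?_⟩, fun h => h.1⟩
  obtain ⟨t, ht, p, q, hL'⟩ := hS.1.exists_top ha (by omega) (by omega)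
  cases t <;> simp only [Left] at hL'
  case valley i c' =>
    obtain rfl : i = a := by omega
    obtain rfl : c' = c := by omega
    exact ht
  all_goals omega

/-- The number of lattice paths with `x` steps in one direction and `y` in the other. -/
def pathCount (x y : ℤ) : ℕ :=
  if 0 ≤ x ∧ 0 ≤ y then (x + y).toNat.choose x.toNat else 0

theorem pathCount_of_neg {x y : ℤ} (h : ¬ (0 ≤ x ∧ 0 ≤ y)) : pathCount x y = 0 := if_neg h

theorem pathCount_natCast (x y : ℕ) : pathCount x y = (x + y).choose x := by
  rw [pathCount, if_pos (by omega)]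
  rfl

theorem pathCount_rec (x y : ℤ) :
    pathCount x y = pathCount (x - 1) y + pathCount x (y - 1) +
      if x = 0 ∧ y = 0 then 1 else 0 := by
  by_cases h : 0 ≤ x ∧ 0 ≤ y
  · obtain ⟨hx, hy⟩ := h
    lift x to ℕ using hx
    lift y to ℕ using hy
    rcases x with _ | x <;> rcases y with _ | y
    · simp [pathCount]
    · rw [if_neg (by omega), pathCount_of_neg (x := ((0 : ℕ) : ℤ) - 1) (by omega),
        show ((y + 1 : ℕ) : ℤ) - 1 = (y : ℕ) by push_cast; ring, pathCount_natCast,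
        pathCount_natCast]
      simp
    · rw [if_neg (by omega), pathCount_of_neg (y := ((0 : ℕ) : ℤ) - 1) (by omega),
        show ((x + 1 : ℕ) : ℤ) - 1 = (x : ℕ) by push_cast; ring, pathCount_natCast,
        pathCount_natCast]
      simp
    · rw [if_neg (by omega), show ((x + 1 : ℕ) : ℤ) - 1 = (x : ℕ) by push_cast; ring,
        show ((y + 1 : ℕ) : ℤ) - 1 = (y : ℕ) by push_cast; ring, pathCount_natCast,
        pathCount_natCast, pathCount_natCast, show x + 1 + (y + 1) = (x + y + 1) + 1 by ring,
        Nat.choose_succ_succ, show x + (y + 1) = x + y + 1 by ring,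
        show x + 1 + y = x + y + 1 by ring]
      rfl
  · rw [pathCount_of_neg h, pathCount_of_neg (x := x - 1) (by omega),
      pathCount_of_neg (y := y - 1) (by omega), if_neg (by omega)]

/-- The number of tilings below a wide edge from `(0, a)` to `(2, b)`. -/
def numWide (a b : ℕ) : ℕ := numFillings a (a + b) (a + b) b

/-- The contribution of the tilings whose topmost wide edge joins `(0, i)` and `(2, j)`. -/
def wideTerm (a c d b : ℤ) (i j : ℕ) : ℕ :=
  if (i + j) % 2 = 1 then
    numWide i j * pathCount (a - i) (c - (i + j + 1) / 2) * pathCount (b - j) (d - (i + j + 1) / 2)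
  else 0

/-- The closed form of `numFillings a (2 * c) (2 * d) b`, valid when `a ≤ A` and `b ≤ B`. -/
def fillingSum (A B : ℕ) (a c d b : ℤ) : ℕ :=
  pathCount a c * pathCount b d +
    ∑ i ∈ Finset.range (A + 1), ∑ j ∈ Finset.range (B + 1), wideTerm a c d b i j

theorem wideTerm_rec_left (a c d b : ℤ) (i j : ℕ) :
    wideTerm a c d b i j = wideTerm (a - 1) c d b i j + wideTerm a (c - 1) d b i j +
      if (i + j) % 2 = 1 ∧ a = i ∧ c = (i + j + 1) / 2 then
        numWide i j * pathCount (b - j) (d - (i + j + 1) / 2) else 0 := by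
  unfold wideTerm
  by_cases h : (i + j) % 2 = 1
  · simp only [h, true_and]
    rw [pathCount_rec (a - i), show a - i - 1 = a - 1 - i by ring,
      show c - ((i : ℤ) + j + 1) / 2 - 1 = c - 1 - (i + j + 1) / 2 by ring]
    simp only [sub_eq_zero]
    split_ifs <;> ring
  · simp [h]

theorem wideTerm_rec_right (a c d b : ℤ) (i j : ℕ) :
    wideTerm a c d b i j = wideTerm a c d (b - 1) i j + wideTerm a c (d - 1) b i j +
      if (i + j) % 2 = 1 ∧ b = j ∧ d = (i + j + 1) / 2 then
        numWide i j * pathCount (a - i) (c - (i + j + 1) / 2) else 0 := by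
  unfold wideTerm
  by_cases h : (i + j) % 2 = 1
  · simp only [h, true_and]
    rw [pathCount_rec (b - j), show b - j - 1 = b - 1 - j by ring,
      show d - ((i : ℤ) + j + 1) / 2 - 1 = d - 1 - (i + j + 1) / 2 by ring]
    simp only [sub_eq_zero]
    split_ifs <;> ring
  · simp [h]

theorem fillingSum_rec_left {A B : ℕ} {a c d b : ℤ} (ha : 0 ≤ a) (haA : a ≤ A)
    (hbB : b ≤ B) (hdc : d ≤ c) (hpos : 0 < a + c) :
    fillingSum A B a c d b = fillingSum A B (a - 1) c d b + fillingSum A B a (c - 1) d b +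
      if d = c ∧ 0 ≤ 2 * c - 1 - a ∧ 2 * c - 1 - a ≤ b then
        numFillings a (2 * c - 1) (2 * c - 1) (2 * c - 1 - a) else 0 := by
  unfold fillingSum
  rw [Finset.sum_congr rfl fun i _ => Finset.sum_congr rfl fun j _ => wideTerm_rec_left a c d b i j]
  simp only [Finset.sum_add_distrib]
  rw [pathCount_rec a c, if_neg (by omega)]
  have hcorner : ∑ i ∈ Finset.range (A + 1), ∑ j ∈ Finset.range (B + 1),
      (if (i + j) % 2 = 1 ∧ a = i ∧ c = ((i : ℤ) + j + 1) / 2 then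
        numWide i j * pathCount (b - j) (d - (i + j + 1) / 2) else 0) =
      if d = c ∧ 0 ≤ 2 * c - 1 - a ∧ 2 * c - 1 - a ≤ b then
        numFillings a (2 * c - 1) (2 * c - 1) (2 * c - 1 - a) else 0 := by
    split_ifs with h
    · obtain ⟨rfl, h₁, h₂⟩ := h
      lift a to ℕ using ha
      obtain ⟨j₀, hj₀⟩ := Int.eq_ofNat_of_zero_le h₁
      rw [Finset.sum_eq_single a, Finset.sum_eq_single j₀, if_pos (by omega), numWide,
        show b - j₀ = ((b - j₀).toNat : ℕ) by omega,
        show d - ((a : ℤ) + j₀ + 1) / 2 = (0 : ℕ) by omega, pathCount_natCast, hj₀,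
        show (a : ℤ) + j₀ = 2 * d - 1 by omega]
      · simp
      · intro j _ hj
        rw [if_neg (by omega)]
      · intro hj
        simp only [Finset.mem_range] at hj
        omega
      · intro i _ hi
        exact Finset.sum_eq_zero fun j _ => if_neg (by omega)
      · intro hi
        simp only [Finset.mem_range] at hi
        omega
    · refine Finset.sum_eq_zero fun i _ => Finset.sum_eq_zero fun j _ => ?_
      split_ifs with h'
      · rw [pathCount_of_neg (by omega), mul_zero]
      · rfl
  rw [hcorner]
  ring

theorem fillingSum_rec_right {A B : ℕ} {a c d b : ℤ} (hcd : c < d ∨ d = 0) (hpos : 0 < b + d) :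
    fillingSum A B a c d b = fillingSum A B a c d (b - 1) + fillingSum A B a c (d - 1) b := by
  unfold fillingSum
  rw [Finset.sum_congr rfl fun i _ => Finset.sum_congr rfl fun j _ =>
    wideTerm_rec_right a c d b i j]
  simp only [Finset.sum_add_distrib]
  rw [pathCount_rec b d, if_neg (by omega)]
  have hcorner : ∑ i ∈ Finset.range (A + 1), ∑ j ∈ Finset.range (B + 1),
      (if (i + j) % 2 = 1 ∧ b = j ∧ d = ((i : ℤ) + j + 1) / 2 then
        numWide i j * pathCount (a - i) (c - (i + j + 1) / 2) else 0) = 0 := by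
    refine Finset.sum_eq_zero fun i _ => Finset.sum_eq_zero fun j _ => ?_
    split_ifs with h'
    · rw [pathCount_of_neg (by omega), mul_zero]
    · rfl
  rw [hcorner]
  ring

theorem fillingSum_of_neg {A B : ℕ} {a c d b : ℤ} (h : a < 0 ∨ c < 0 ∨ d < 0 ∨ b < 0) :
    fillingSum A B a c d b = 0 := by
  have hprod : ∀ x y z w : ℤ, x < 0 ∨ y < 0 ∨ z < 0 ∨ w < 0 →
      pathCount x y * pathCount w z = 0 := by
    intro x y z w h
    by_cases h' : 0 ≤ x ∧ 0 ≤ y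
    · rw [pathCount_of_neg (x := w) (by omega), mul_zero]
    · rw [pathCount_of_neg h', zero_mul]
  rw [fillingSum, hprod _ _ _ _ h, zero_add]
  refine Finset.sum_eq_zero fun i _ => Finset.sum_eq_zero fun j _ => ?_
  rw [wideTerm, mul_assoc, hprod _ _ _ _ (by omega), mul_zero, ite_self]

theorem fillingSum_zero (A B : ℕ) : fillingSum A B 0 0 0 0 = 1 := by
  rw [fillingSum, Finset.sum_eq_zero, show (0 : ℤ) = (0 : ℕ) by rfl, pathCount_natCast]
  · simp
  · refine fun i _ => Finset.sum_eq_zero fun j _ => ?_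
    rw [wideTerm]
    split_ifs
    · rw [pathCount_of_neg (x := 0 - (i : ℤ)) (by omega)]
      simp
    · rfl

theorem numFillings_eq_fillingSum (A B : ℕ) {a b c d : ℤ} (ha : 0 ≤ a) (haA : a ≤ A) (hb : 0 ≤ b)
    (hbB : b ≤ B) (hc : 0 ≤ c) (hd : 0 ≤ d) :
    numFillings a (2 * c) (2 * d) b = fillingSum A B a c d b := by
  obtain ⟨n, hn⟩ := Int.eq_ofNat_of_zero_le (by omega : 0 ≤ a + b + c + d)
  induction n generalizing a b c d with
  | zero =>
    obtain ⟨rfl, rfl, rfl, rfl⟩ : a = 0 ∧ b = 0 ∧ c = 0 ∧ d = 0 := by omega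
    rw [fillingSum_zero]
    exact numFillings_zero
  | succ n ih =>
    by_cases h : d ≤ c ∧ 0 < a + c
    · rw [numFillings_rec ha hd h.1 h.2, fillingSum_rec_left ha haA hbB h.1 h.2]
      congr 2
      · split_ifs
        · exact ih (by omega) (by omega) hb hbB hc hd (by omega)
        · rw [fillingSum_of_neg (by omega)]
      · split_ifs
        · exact ih ha haA hb hbB (by omega) hd (by omega)
        · rw [fillingSum_of_neg (by omega)]
    · rw [numFillings_symm, numFillings_rec hb hc (by omega) (by omega),
        fillingSum_rec_right (by omega) (by omega), if_neg (c := c = d ∧ _) (by omega), add_zero]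
      congr 1
      · split_ifs
        · rw [numFillings_symm]
          exact ih ha haA (by omega) (by omega) hc hd (by omega)
        · rw [fillingSum_of_neg (by omega)]
      · split_ifs
        · rw [numFillings_symm]
          exact ih ha haA hb hbB hc (by omega) (by omega)
        · rw [fillingSum_of_neg (by omega)]

theorem numWide_rec (A B : ℕ) (hpar : (A + B) % 2 = 1) :
    numWide A B =
      Nat.choose ((3 * A + B - 1) / 2) A * Nat.choose ((A + 3 * B - 1) / 2) B +
      ∑ a ∈ Finset.range (A + 1), ∑ b ∈ Finset.range (B + 1),
        (if (a + b) % 2 = 1 ∧ a + b < A + B then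
          numWide a b * Nat.choose ((3 * A + B - 3 * a - b) / 2 - 1) (A - a) *
            Nat.choose ((A + 3 * B - a - 3 * b) / 2 - 1) (B - b)
        else 0) := by
  obtain ⟨c, hc⟩ : ∃ c : ℕ, A + B = 2 * c + 1 := ⟨(A + B) / 2, by omega⟩
  rw [numWide, numFillings_wide (c := c) (by omega) (by omega) (by omega),
    numFillings_eq_fillingSum A B (by omega) le_rfl (by omega) le_rfl (by omega) (by omega),
    fillingSum, pathCount_natCast, pathCount_natCast]
  congr 1
  · congr 2 <;> omega
  · refine Finset.sum_congr rfl fun a ha => Finset.sum_congr rfl fun b hb => ?_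
    rw [Finset.mem_range] at ha hb
    rw [wideTerm]
    split_ifs with h₁ h₂ h₂
    · rw [show (A : ℤ) - a = (A - a : ℕ) by omega, show (B : ℤ) - b = (B - b : ℕ) by omega,
        show (c : ℤ) - (a + b + 1) / 2 = (c - (a + b + 1) / 2 : ℕ) by omega, pathCount_natCast,
        pathCount_natCast]
      congr 2
      · congr 1
        omega
      · omega
    · rw [pathCount_of_neg (y := (c : ℤ) - (a + b + 1) / 2) (by omega)]
      simp
    · exact (h₁ h₂.1).elim
    · rfl

theorem mem_convexHull_triple {p q r z : ℝ × ℝ} :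
    z ∈ convexHull ℝ {p, q, r} ↔ ∃ α β γ : ℝ, 0 ≤ α ∧ 0 ≤ β ∧ 0 ≤ γ ∧ α + β + γ = 1 ∧
      z.1 = α * p.1 + β * q.1 + γ * r.1 ∧ z.2 = α * p.2 + β * q.2 + γ * r.2 := by
  rw [convexHull_insert (by simp), convexHull_pair]
  simp only [convexJoin_singleton_left, mem_iUnion, exists_prop]
  constructor
  · rintro ⟨w, ⟨a, b, ha, hb, hab, rfl⟩, c, d, hc, hd, hcd, rfl⟩
    refine ⟨c, d * a, d * b, hc, by positivity, by positivity, ?_, ?_, ?_⟩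
    · rw [add_assoc, ← mul_add, hab, mul_one, hcd]
    all_goals simp; ring
  · rintro ⟨α, β, γ, hα, hβ, hγ, hsum, h₁, h₂⟩
    rcases (add_nonneg hβ hγ).eq_or_lt with h | h
    · obtain rfl : β = 0 := by linarith
      obtain rfl : γ = 0 := by linarith
      obtain rfl : α = 1 := by linarith
      exact ⟨q, left_mem_segment ℝ q r, 1, 0, by simp, le_rfl, by simp,
        by ext <;> simp [h₁, h₂]⟩
    · refine ⟨(β / (β + γ)) • q + (γ / (β + γ)) • r, ⟨β / (β + γ), γ / (β + γ), by positivity,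
        by positivity, by field_simp, rfl⟩, α, β + γ, hα, h.le, by linarith, ?_⟩
      ext
      · simp only [Prod.fst_add, Prod.smul_fst, smul_eq_mul, h₁]
        field_simp
        ring
      · simp only [Prod.snd_add, Prod.smul_snd, smul_eq_mul, h₂]
        field_simp
        ring

theorem affineIndependent_of_triDet_ne_zero {p q r : ℝ × ℝ} (h : triDet p q r ≠ 0) :
    AffineIndependent ℝ ![p, q, r] := by
  rw [affineIndependent_iff_not_collinear_set, collinear_iff_of_mem (p₀ := p) (by simp)]
  rintro ⟨v, hv⟩
  obtain ⟨s, rfl⟩ := hv q (by simp)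
  obtain ⟨u, rfl⟩ := hv r (by simp)
  refine h ?_
  simp [triDet]
  ring

theorem interior_segment_eq_empty (p q : ℝ × ℝ) : interior (segment ℝ p q) = ∅ := by
  refine eq_empty_of_forall_notMem fun z hz => ?_
  obtain ⟨ε, hε, hball⟩ := Metric.isOpen_iff.1 isOpen_interior z hz
  have key : ∀ u v : ℝ, |u| < ε → |v| < ε → (z.1 + u, z.2 + v) ∈ segment ℝ p q := by
    intro u v hu hv
    refine interior_subset (hball ?_)
    rw [Metric.mem_ball, Prod.dist_eq]
    simpa [Real.dist_eq] using And.intro hu hv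
  have hcol : ∀ w ∈ segment ℝ p q, (q.1 - p.1) * (w.2 - p.2) = (q.2 - p.2) * (w.1 - p.1) := by
    rintro w ⟨a, b, -, -, hab, rfl⟩
    obtain rfl : a = 1 - b := by linarith
    simp
    ring
  have hδ : |ε / 2| < ε := by rw [abs_of_pos (by positivity)]; linarith
  have h0 : |(0 : ℝ)| < ε := by simpa using hε
  have e₀ := hcol _ (key 0 0 h0 h0)
  have e₁ := hcol _ (key (ε / 2) 0 hδ h0)
  have e₂ := hcol _ (key 0 (ε / 2) h0 hδ)
  simp only [add_zero] at e₀ e₁ e₂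
  have h₁ : (q.2 - p.2) * (ε / 2) = 0 := by linarith
  have h₂ : (q.1 - p.1) * (ε / 2) = 0 := by linarith
  have hne : ε / 2 ≠ 0 := by positivity
  have hpq : q = p := by
    ext
    · linarith [(mul_eq_zero.1 h₂).resolve_right hne]
    · linarith [(mul_eq_zero.1 h₁).resolve_right hne]
  have m₀ := key 0 0 h0 h0
  have m₁ := key (ε / 2) 0 hδ h0
  rw [hpq, segment_same, mem_singleton_iff] at m₀ m₁
  have := congrArg Prod.fst (m₀.trans m₁.symm)
  simp at this
  exact hε.ne' this

theorem IsFaceOf.eq_of_interior_nonempty {F Δ : Set (ℝ × ℝ)} (h : IsFaceOf F Δ)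
    (hF : (interior F).Nonempty) : F = Δ := by
  obtain ⟨p, q, r, -, -, h⟩ := h
  have hs : ∀ p q : ℝ × ℝ, F ≠ segment ℝ p q := by
    rintro p q rfl
    simp [interior_segment_eq_empty] at hF
  have hp : ∀ p : ℝ × ℝ, F ≠ {p} := fun p => segment_same ℝ p ▸ hs p p
  rcases h with rfl | h | h | h | h | h | h | h
  · simp at hF
  all_goals first | exact h | exact (hs _ _ h).elim | exact (hp _ h).elim

/-- If every common point of a triangle and a convex set lies on a segment between vertices of the
triangle that belong to the convex set, then the intersection is a face. -/
theorem isFaceOf_of_segments {p q r : ℝ × ℝ} {C : Set (ℝ × ℝ)}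
    (hind : AffineIndependent ℝ ![p, q, r]) (hC : Convex ℝ C)
    (h : ∀ z ∈ convexHull ℝ {p, q, r} ∩ C, ∃ v w : ℝ × ℝ, v ∈ ({p, q, r} : Set (ℝ × ℝ)) ∧
      w ∈ ({p, q, r} : Set (ℝ × ℝ)) ∧ v ∈ C ∧ w ∈ C ∧ z ∈ segment ℝ v w) :
    IsFaceOf (convexHull ℝ {p, q, r} ∩ C) (convexHull ℝ {p, q, r}) := by
  have hC' : Convex ℝ (convexHull ℝ {p, q, r} ∩ C) := (convex_convexHull ℝ _).inter hC
  have heq : convexHull ℝ {p, q, r} ∩ C = convexHull ℝ ({p, q, r} ∩ C) := by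
    refine Subset.antisymm (fun z hz => ?_) (convexHull_min ?_ hC')
    · obtain ⟨v, w, hv, hw, hvC, hwC, hz'⟩ := h z hz
      exact segment_subset_convexHull (s := {p, q, r} ∩ C) ⟨hv, hvC⟩ ⟨hw, hwC⟩ hz'
    · exact inter_subset_inter_left _ (subset_convexHull ℝ _)
  refine ⟨p, q, r, hind, rfl, ?_⟩
  rw [heq]
  by_cases hp : p ∈ C <;> by_cases hq : q ∈ C <;> by_cases hr : r ∈ C <;>
    simp [insert_inter_of_mem, insert_inter_of_notMem, hp, hq, hr, convexHull_pair]

namespace Tile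

/-- The vertices of a tile. -/
def vertex : Tile → Fin 3 → ℤ × ℤ
  | leftOuter i c => ![(0, i), (0, i + 1), (1, c)]
  | leftInner i c => ![(0, i), (1, c), (1, c + 1)]
  | rightOuter j c => ![(2, j), (2, j + 1), (1, c)]
  | rightInner j c => ![(2, j), (1, c), (1, c + 1)]
  | peak i c => ![(0, i), (1, c), (2, 2 * c - 1 - i)]
  | valley i c => ![(0, i), (1, c), (2, 2 * c + 1 - i)]

/-- A lattice point as a point of the plane. -/
def toPlane (v : ℤ × ℤ) : ℝ × ℝ := (v.1, v.2)

/-- The triangle encoded by a tile. -/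
def toSet (t : Tile) : Set (ℝ × ℝ) :=
  convexHull ℝ {toPlane (t.vertex 0), toPlane (t.vertex 1), toPlane (t.vertex 2)}

/-- `(x, y)` belongs to the part of `t` in `0 ≤ x ≤ 1`. -/
def MemLeft (t : Tile) (x y : ℝ) : Prop :=
  0 ≤ x ∧ x ≤ 1 ∧ ∃ p q p' q', t.Left p q p' q' ∧ height p q x ≤ y ∧ y ≤ height p' q' x

theorem abs_triDet_vertex (t : Tile) :
    |triDet (toPlane (t.vertex 0)) (toPlane (t.vertex 1)) (toPlane (t.vertex 2))| = 1 := by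
  have h : ∀ x : ℝ, x = 1 ∨ x = -1 → |x| = 1 := by rintro x (rfl | rfl) <;> simp
  apply h
  cases t <;> simp [triDet, toPlane, vertex] <;> ring_nf <;> simp

theorem affineIndependent_vertex (t : Tile) : AffineIndependent ℝ
    ![toPlane (t.vertex 0), toPlane (t.vertex 1), toPlane (t.vertex 2)] := by
  refine affineIndependent_of_triDet_ne_zero fun h => ?_
  simpa [h] using t.abs_triDet_vertex

theorem mem_toSet {t : Tile} {x y : ℝ} :
    (x, y) ∈ t.toSet ↔ t.MemLeft x y ∨ t.mirror.MemLeft (2 - x) y := by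
  rw [toSet, mem_convexHull_triple]
  constructor
  · rintro ⟨α, β, γ, hα, hβ, hγ, hsum, hx, hy⟩
    obtain rfl : α = 1 - β - γ := by linarith
    cases t <;> simp [vertex, toPlane] at hx hy <;> subst hx hy
    case leftOuter i c =>
      refine Or.inl ⟨by linarith, by linarith, _, _, _, _, ⟨rfl, rfl, rfl, rfl⟩, ?_, ?_⟩ <;>
        simp [height] <;> linarith
    case leftInner i c =>
      refine Or.inl ⟨by linarith, by linarith, _, _, _, _, ⟨rfl, rfl, rfl, rfl⟩, ?_, ?_⟩ <;>
        simp [height] <;> linarith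
    case rightOuter i c =>
      refine Or.inr ⟨by linarith, by linarith, _, _, _, _, ⟨rfl, rfl, rfl, rfl⟩, ?_, ?_⟩ <;>
        simp [height] <;> linarith
    case rightInner i c =>
      refine Or.inr ⟨by linarith, by linarith, _, _, _, _, ⟨rfl, rfl, rfl, rfl⟩, ?_, ?_⟩ <;>
        simp [height] <;> linarith
    all_goals
      rcases le_total (β + γ * 2) 1 with h | h
      · refine Or.inl ⟨by linarith, by linarith, _, _, _, _, ⟨rfl, rfl, rfl, rfl⟩, ?_, ?_⟩ <;>
          simp [height] <;> linarith
      · refine Or.inr ⟨by linarith, by linarith, _, _, _, _, ⟨rfl, rfl, rfl, rfl⟩, ?_, ?_⟩ <;>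
          simp [height] <;> linarith
  · rintro (⟨h₀, h₁, p, q, p', q', hL, hy, hy'⟩ | ⟨h₀, h₁, p, q, p', q', hL, hy, hy'⟩)
    · cases t <;> simp only [Left] at hL <;> obtain ⟨rfl, rfl, rfl, rfl⟩ := hL <;>
        simp [height] at hy hy'
      case leftOuter c =>
        refine ⟨1 - x - (y - p * (1 - x) - c * x), y - p * (1 - x) - c * x, x, ?_⟩
        simp [vertex, toPlane]
        refine ⟨?_, ?_, ?_, ?_⟩ <;> linarith
      case leftInner c =>
        refine ⟨1 - x, x - (y - p' * (1 - x) - c * x), y - p' * (1 - x) - c * x, ?_⟩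
        simp [vertex, toPlane]
        refine ⟨?_, ?_, ?_, ?_⟩ <;> linarith
      case peak c =>
        refine ⟨1 - x / 2 - (y - p' * (1 - x) - (2 * c - 1) / 2 * x),
          2 * (y - p' * (1 - x) - (2 * c - 1) / 2 * x),
          x / 2 - (y - p' * (1 - x) - (2 * c - 1) / 2 * x), ?_⟩
        simp [vertex, toPlane]
        refine ⟨?_, ?_, ?_, ?_, ?_, ?_⟩ <;> linarith
      case valley c =>
        refine ⟨1 - x / 2 - (p' * (1 - x) + (2 * c + 1) / 2 * x - y),
          2 * (p' * (1 - x) + (2 * c + 1) / 2 * x - y),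
          x / 2 - (p' * (1 - x) + (2 * c + 1) / 2 * x - y), ?_⟩
        simp [vertex, toPlane]
        refine ⟨?_, ?_, ?_, ?_, ?_, ?_⟩ <;> linarith
    · cases t <;> simp only [Left, mirror] at hL <;> obtain ⟨rfl, rfl, rfl, rfl⟩ := hL <;>
        simp [height] at hy hy'
      case rightOuter c =>
        refine ⟨x - 1 - (y - p * (x - 1) - c * (2 - x)), y - p * (x - 1) - c * (2 - x), 2 - x, ?_⟩
        simp [vertex, toPlane]
        refine ⟨?_, ?_, ?_, ?_, ?_, ?_⟩ <;> linarith
      case rightInner c =>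
        refine ⟨x - 1, 2 - x - (y - p' * (x - 1) - c * (2 - x)), y - p' * (x - 1) - c * (2 - x), ?_⟩
        simp [vertex, toPlane]
        refine ⟨?_, ?_, ?_, ?_, ?_, ?_⟩ <;> linarith
      case peak i c =>
        refine ⟨1 - x / 2 - (y - i * (1 - x) - (2 * c - 1) / 2 * x),
          2 * (y - i * (1 - x) - (2 * c - 1) / 2 * x),
          x / 2 - (y - i * (1 - x) - (2 * c - 1) / 2 * x), ?_⟩
        simp [vertex, toPlane]
        refine ⟨?_, ?_, ?_, ?_, ?_, ?_⟩ <;> linarith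
      case valley i c =>
        refine ⟨1 - x / 2 - (i * (1 - x) + (2 * c + 1) / 2 * x - y),
          2 * (i * (1 - x) + (2 * c + 1) / 2 * x - y),
          x / 2 - (i * (1 - x) + (2 * c + 1) / 2 * x - y), ?_⟩
        simp [vertex, toPlane]
        refine ⟨?_, ?_, ?_, ?_, ?_, ?_⟩ <;> linarith

theorem exists_toSet_eq_of_le {p q r : ℤ × ℤ} (hp : 0 ≤ p.1) (hpq : p.1 ≤ q.1) (hqr : q.1 ≤ r.1)
    (hr : r.1 ≤ 2) (hdet : |triDet (toPlane p) (toPlane q) (toPlane r)| = 1) :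
    ∃ t : Tile, t.toSet = convexHull ℝ {toPlane p, toPlane q, toPlane r} := by
  obtain ⟨p₁, p₂⟩ := p
  obtain ⟨q₁, q₂⟩ := q
  obtain ⟨r₁, r₂⟩ := r
  have hdet' : |(q₁ - p₁) * (r₂ - p₂) - (q₂ - p₂) * (r₁ - p₁)| = 1 := by
    simp only [triDet, toPlane] at hdet
    exact_mod_cast hdet
  rw [abs_eq (by norm_num)] at hdet'
  simp only at hp hpq hqr hr
  have hcases : (p₁ = 0 ∨ p₁ = 1 ∨ p₁ = 2) ∧ (q₁ = 0 ∨ q₁ = 1 ∨ q₁ = 2) ∧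
      (r₁ = 0 ∨ r₁ = 1 ∨ r₁ = 2) := by omega
  obtain ⟨rfl | rfl | rfl, rfl | rfl | rfl, rfl | rfl | rfl⟩ := hcases <;> try omega
  · rcases hdet' with h | h
    · obtain rfl : q₂ = p₂ - 1 := by omega
      exact ⟨leftOuter (p₂ - 1) r₂, by
        rw [toSet, insert_comm]; simp [vertex]⟩
    · obtain rfl : q₂ = p₂ + 1 := by omega
      exact ⟨leftOuter p₂ r₂, by rw [toSet]; simp [vertex]⟩
  · rcases hdet' with h | h
    · obtain rfl : r₂ = q₂ + 1 := by omega
      exact ⟨leftInner p₂ q₂, by rw [toSet]; simp [vertex]⟩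
    · obtain rfl : r₂ = q₂ - 1 := by omega
      exact ⟨leftInner p₂ (q₂ - 1), by rw [toSet, pair_comm]; simp [vertex]⟩
  · rcases hdet' with h | h
    · obtain rfl : r₂ = 2 * q₂ - 1 - p₂ + 2 := by omega
      exact ⟨valley p₂ q₂, by
        rw [toSet]; simp [vertex, show 2 * q₂ - 1 - p₂ + 2 = 2 * q₂ + 1 - p₂ by ring]⟩
    · obtain rfl : r₂ = 2 * q₂ - 1 - p₂ := by omega
      exact ⟨peak p₂ q₂, by rw [toSet]; simp [vertex]⟩
  · rcases hdet' with h | h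
    · obtain rfl : q₂ = p₂ - 1 := by omega
      exact ⟨rightInner r₂ (p₂ - 1), by
        rw [toSet, insert_comm, pair_comm, insert_comm]; simp [vertex]⟩
    · obtain rfl : q₂ = p₂ + 1 := by omega
      exact ⟨rightInner r₂ p₂, by rw [toSet, insert_comm, pair_comm]; simp [vertex]⟩
  · rcases hdet' with h | h
    · obtain rfl : r₂ = q₂ + 1 := by omega
      exact ⟨rightOuter q₂ p₂, by rw [toSet, pair_comm, insert_comm]; simp [vertex]⟩
    · obtain rfl : r₂ = q₂ - 1 := by omega
      exact ⟨rightOuter (q₂ - 1) p₂, by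
        rw [toSet, pair_comm, insert_comm, pair_comm]; simp [vertex]⟩

theorem toSet_unimodular (t : Tile) : IsUnimodularTriangle t.toSet :=
  ⟨_, _, _, ⟨_, _, rfl⟩, ⟨_, _, rfl⟩, ⟨_, _, rfl⟩, t.affineIndependent_vertex, rfl,
    t.abs_triDet_vertex⟩

/-- Every unimodular triangle in the strip `0 ≤ x ≤ 2` is a tile. -/
theorem exists_toSet_eq {Δ : Set (ℝ × ℝ)} (h : IsUnimodularTriangle Δ)
    (hstrip : ∀ z ∈ Δ, 0 ≤ z.1 ∧ z.1 ≤ 2) : ∃ t : Tile, t.toSet = Δ := by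
  have hswap₁ : ∀ p q r, triDet q p r = -triDet p q r := fun p q r => by unfold triDet; ring
  have hswap₂ : ∀ p q r, triDet p r q = -triDet p q r := fun p q r => by unfold triDet; ring
  have main : ∀ p q r : ℤ × ℤ, (0 ≤ p.1 ∧ p.1 ≤ 2) → (0 ≤ q.1 ∧ q.1 ≤ 2) →
      (0 ≤ r.1 ∧ r.1 ≤ 2) → |triDet (toPlane p) (toPlane q) (toPlane r)| = 1 →
      ∃ t : Tile, t.toSet = convexHull ℝ {toPlane p, toPlane q, toPlane r} := by
    have first : ∀ p q r : ℤ × ℤ, (0 ≤ p.1 ∧ p.1 ≤ 2) → (0 ≤ q.1 ∧ q.1 ≤ 2) →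
        (0 ≤ r.1 ∧ r.1 ≤ 2) → p.1 ≤ q.1 →
        |triDet (toPlane p) (toPlane q) (toPlane r)| = 1 →
        ∃ t : Tile, t.toSet = convexHull ℝ {toPlane p, toPlane q, toPlane r} := by
      intro p q r hp hq hr hpq hdet
      rcases le_total q.1 r.1 with hqr | hqr
      · exact exists_toSet_eq_of_le hp.1 hpq hqr hr.2 hdet
      rcases le_total p.1 r.1 with hpr | hpr
      · rw [pair_comm]
        exact exists_toSet_eq_of_le hp.1 hpr hqr hq.2 (by rwa [hswap₂, abs_neg])
      · rw [pair_comm, insert_comm]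
        exact exists_toSet_eq_of_le hr.1 hpr hpq hq.2 (by rwa [hswap₁, hswap₂, neg_neg])
    intro p q r hp hq hr hdet
    rcases le_total p.1 q.1 with hpq | hpq
    · exact first p q r hp hq hr hpq hdet
    · rw [insert_comm]
      exact first q p r hq hp hr hpq (by rwa [hswap₁, abs_neg])
  obtain ⟨_, _, _, ⟨p₁, p₂, rfl⟩, ⟨q₁, q₂, rfl⟩, ⟨r₁, r₂, rfl⟩, -, rfl, hdet⟩ := h
  have hbound : ∀ a b : ℤ, ((a : ℝ), (b : ℝ)) ∈ convexHull ℝ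
      ({((p₁ : ℝ), (p₂ : ℝ)), ((q₁ : ℝ), (q₂ : ℝ)), ((r₁ : ℝ), (r₂ : ℝ))} : Set (ℝ × ℝ)) →
      0 ≤ a ∧ a ≤ 2 := by
    intro a b hz
    have : (0 : ℝ) ≤ a ∧ (a : ℝ) ≤ 2 := hstrip _ hz
    exact_mod_cast this
  exact main (p₁, p₂) (q₁, q₂) (r₁, r₂) (hbound p₁ p₂ (subset_convexHull ℝ _ (by simp)))
    (hbound q₁ q₂ (subset_convexHull ℝ _ (by simp)))
    (hbound r₁ r₂ (subset_convexHull ℝ _ (by simp))) hdet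

theorem mem_toSet_mirror {t : Tile} {x y : ℝ} :
    (x, y) ∈ t.mirror.toSet ↔ (2 - x, y) ∈ t.toSet := by
  rw [mem_toSet, mem_toSet, mirror_mirror, sub_sub_cancel, or_comm]

theorem MemLeft.mem_toSet {t : Tile} {x y : ℝ} (h : t.MemLeft x y) : (x, y) ∈ t.toSet :=
  Tile.mem_toSet.2 (Or.inl h)

theorem MemLeft.of_mem_toSet {t : Tile} {x y : ℝ} (h : (x, y) ∈ t.toSet) (hx : x < 1) :
    t.MemLeft x y := by
  rcases Tile.mem_toSet.1 h with h | ⟨-, h, -⟩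
  · exact h
  · linarith

theorem toSet_injective : Function.Injective toSet := by
  have key : ∀ {t t' : Tile} {p q p' q' : ℤ}, t.toSet ⊆ t'.toSet → t.Left p q p' q' →
      ∃ r s r' s', t'.Left r s r' s' ∧ ∀ x : ℝ, 0 < x → x < 1 →
        height r s x ≤ height p q x ∧ height p' q' x ≤ height r' s' x := by
    intro t t' p q p' q' hsub hL
    have hle : ∀ x : ℝ, 0 < x → x < 1 → height p q x ≤ height p' q' x := fun x hx hx' =>
      (height_lt_height hx hx' hL.le.1 hL.le.2.1 hL.le.2.2).le
    have hlo : ∀ x : ℝ, 0 < x → x < 1 → t'.MemLeft x (height p q x) := fun x hx hx' =>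
      .of_mem_toSet (hsub (MemLeft.mem_toSet
        ⟨hx.le, hx'.le, p, q, p', q', hL, le_rfl, hle x hx hx'⟩)) hx'
    have hup : ∀ x : ℝ, 0 < x → x < 1 → t'.MemLeft x (height p' q' x) := fun x hx hx' =>
      .of_mem_toSet (hsub (MemLeft.mem_toSet
        ⟨hx.le, hx'.le, p, q, p', q', hL, hle x hx hx', le_rfl⟩)) hx'
    obtain ⟨-, -, r, s, r', s', hL', -⟩ := hlo (1 / 2) (by norm_num) (by norm_num)
    refine ⟨r, s, r', s', hL', fun x hx hx' => ?_⟩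
    obtain ⟨-, -, r₁, s₁, r₂, s₂, h₁, h₂, -⟩ := hlo x hx hx'
    obtain ⟨-, -, r₃, s₃, r₄, s₄, h₃, -, h₄⟩ := hup x hx hx'
    obtain ⟨rfl, rfl, rfl, rfl⟩ := h₁.unique hL'
    obtain ⟨rfl, rfl, rfl, rfl⟩ := h₃.unique h₁
    exact ⟨h₂, h₄⟩
  have hline : ∀ p q r s : ℤ, (∀ x : ℝ, 0 < x → x < 1 → height p q x = height r s x) →
      p = r ∧ q = s := by
    intro p q r s h
    have h₁ := h (1 / 2) (by norm_num) (by norm_num)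
    have h₂ := h (1 / 4) (by norm_num) (by norm_num)
    unfold height at h₁ h₂
    have hp : (p : ℝ) = r := by linarith
    have hq : (q : ℝ) = s := by linarith
    exact ⟨by exact_mod_cast hp, by exact_mod_cast hq⟩
  have main : ∀ {t t' : Tile} {p q p' q' : ℤ}, t.toSet = t'.toSet → t.Left p q p' q' → t = t' := by
    intro t t' p q p' q' heq hL
    obtain ⟨r, s, r', s', hL', h⟩ := key heq.subset hL
    obtain ⟨p₁, q₁, p₂, q₂, hL₁, h'⟩ := key heq.symm.subset hL'
    obtain ⟨rfl, rfl, rfl, rfl⟩ := hL₁.unique hL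
    obtain ⟨rfl, rfl⟩ := hline _ _ _ _ fun x hx hx' =>
      le_antisymm (h' x hx hx').1 (h x hx hx').1
    obtain ⟨rfl, rfl⟩ := hline _ _ _ _ fun x hx hx' =>
      le_antisymm (h x hx hx').2 (h' x hx hx').2
    exact hL.tile_eq hL'
  intro t t' heq
  rcases t.exists_left_or_right with ⟨p, q, p', q', hL⟩ | ⟨p, q, p', q', hL⟩
  · exact main heq hL
  · have : t.mirror = t'.mirror := by
      refine main ?_ hL
      ext ⟨x, y⟩
      rw [mem_toSet_mirror, mem_toSet_mirror, heq]
    rw [← mirror_mirror t, this, mirror_mirror]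

theorem continuous_height (p q : ℤ) : Continuous (height p q) := by
  unfold height
  fun_prop

/-- Two linear forms that are each positive somewhere in the closed quadrant, and whose sum is
positive inside the quadrant, are simultaneously positive at some integer point inside it. -/
theorem exists_pos_combination {a b c d : ℤ} (hab : 0 < a ∨ 0 < b) (hcd : 0 < c ∨ 0 < d)
    (hac : 0 ≤ a + c) (hbd : 0 ≤ b + d) (hpos : 0 < a + c ∨ 0 < b + d) :
    ∃ u v : ℤ, 0 < u ∧ 0 < v ∧ 0 < a * u + b * v ∧ 0 < c * u + d * v := by
  have hbig : ∀ e f k : ℤ, 0 < e → |f| < k → 0 < e * k + f := by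
    intro e f k he hk
    nlinarith [neg_abs_le f, mul_nonneg (by omega : 0 ≤ e - 1) ((abs_nonneg f).trans hk.le)]
  have cross : ∀ {a b c d : ℤ}, 0 < a → 0 < d → b ≤ 0 → c ≤ 0 → 0 ≤ a + c → 0 ≤ b + d →
      (0 < a + c ∨ 0 < b + d) → 0 < a * d - b * c := by
    intro a b c d ha hd hb hc hac hbd hpos
    rcases hpos with h | h
    · nlinarith [mul_pos h hd, mul_nonneg (neg_nonneg.2 hc) hbd]
    · nlinarith [mul_pos ha h, mul_nonneg (neg_nonneg.2 hb) hac]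
  have hb' := abs_nonneg b
  have hd' := abs_nonneg d
  have ha' := abs_nonneg a
  have hc' := abs_nonneg c
  by_cases h₁ : 0 < a ∧ 0 < c
  · refine ⟨|b| + |d| + 1, 1, by positivity, one_pos, ?_, ?_⟩ <;> rw [mul_one]
    exacts [hbig _ _ _ h₁.1 (by omega), hbig _ _ _ h₁.2 (by omega)]
  by_cases h₂ : 0 < b ∧ 0 < d
  · refine ⟨1, |a| + |c| + 1, one_pos, by positivity, ?_, ?_⟩ <;> rw [mul_one, add_comm]
    exacts [hbig _ _ _ h₂.1 (by omega), hbig _ _ _ h₂.2 (by omega)]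
  rcases hab with ha | hb
  · have := cross ha (by omega) (by omega : b ≤ 0) (by omega : c ≤ 0) hac hbd hpos
    exact ⟨d - b, a - c, by omega, by omega, by linarith, by linarith⟩
  · have := cross (a := c) (b := d) (c := a) (d := b) (by omega) hb (by omega) (by omega)
      (by omega) (by omega) (by omega)
    exact ⟨b - d, c - a, by omega, by omega, by linarith, by linarith⟩

theorem interior_inter_nonempty_of_not_leftOrdered {t t' : Tile} (h : ¬ t.LeftOrdered t') :
    (interior (t.toSet ∩ t'.toSet)).Nonempty := by
  simp only [LeftOrdered, not_forall, not_or] at h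
  obtain ⟨p, q, p', q', r, s, r', s', hL, hL', h₁, h₂⟩ := h
  have hle := hL.le
  have hle' := hL'.le
  obtain ⟨u, v, hu, hv, huv, huv'⟩ := exists_pos_combination (a := p' - r) (b := q' - s)
    (c := r' - p) (d := s' - q) (by omega) (by omega) (by omega) (by omega) (by omega)
  have hu' : (0 : ℝ) < u := by exact_mod_cast hu
  have hv' : (0 : ℝ) < v := by exact_mod_cast hv
  have hlt : ∀ a b c d : ℤ, 0 < (c - a) * u + (d - b) * v →
      height a b (2 * v / (u + 2 * v)) < height c d (2 * v / (u + 2 * v)) := by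
    intro a b c d h
    have h' : (0 : ℝ) < (c - a) * u + (d - b) * v := by exact_mod_cast h
    rw [← sub_pos]
    have : height c d (2 * v / (u + 2 * v)) - height a b (2 * v / (u + 2 * v)) =
        ((c - a) * u + (d - b) * v) / (u + 2 * v) := by
      unfold height
      field_simp
      ring
    rw [this]
    positivity
  have hx : (0 : ℝ) < 2 * v / (u + 2 * v) := by positivity
  have hx' : 2 * v / (u + 2 * v) < (1 : ℝ) := by
    rw [div_lt_one (by positivity)]
    linarith
  obtain ⟨y, hy, hy'⟩ := exists_between (max_lt
    (lt_min (height_lt_height hx hx' hle.1 hle.2.1 hle.2.2) (hlt _ _ _ _ huv'))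
    (lt_min (hlt _ _ _ _ huv) (height_lt_height hx hx' hle'.1 hle'.2.1 hle'.2.2)))
  rw [max_lt_iff] at hy
  rw [lt_min_iff] at hy'
  refine ⟨(2 * v / (u + 2 * v), y), mem_interior.2 ⟨{z | (0 < z.1 ∧ z.1 < 1) ∧
    (height p q z.1 < z.2 ∧ height r s z.1 < z.2) ∧
    z.2 < height p' q' z.1 ∧ z.2 < height r' s' z.1}, ?_, ?_, ⟨hx, hx'⟩, hy, hy'⟩⟩
  · rintro ⟨x, y⟩ ⟨⟨hx, hx'⟩, ⟨h₁, h₂⟩, h₃, h₄⟩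
    exact ⟨MemLeft.mem_toSet ⟨hx.le, hx'.le, p, q, p', q', hL, h₁.le, h₃.le⟩,
      MemLeft.mem_toSet ⟨hx.le, hx'.le, r, s, r', s', hL', h₂.le, h₄.le⟩⟩
  · have hc : ∀ p q : ℤ, Continuous fun z : ℝ × ℝ => height p q z.1 := fun p q =>
      (continuous_height p q).comp continuous_fst
    exact ((isOpen_lt continuous_const continuous_fst).inter
      (isOpen_lt continuous_fst continuous_const)).inter
      (((isOpen_lt (hc _ _) continuous_snd).inter (isOpen_lt (hc _ _) continuous_snd)).inter
      ((isOpen_lt continuous_snd (hc _ _)).inter (isOpen_lt continuous_snd (hc _ _))))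

/-- The reflection of the plane in the line `x = 1`. -/
def reflection : ℝ × ℝ ≃ₜ ℝ × ℝ := (Homeomorph.subLeft 2).prodCongr (Homeomorph.refl ℝ)

theorem toSet_mirror (t : Tile) : t.mirror.toSet = reflection ⁻¹' t.toSet := by
  ext ⟨x, y⟩
  exact mem_toSet_mirror

/-- The set of vertices of a tile in the plane. -/
def vertices (t : Tile) : Set (ℝ × ℝ) :=
  {toPlane (t.vertex 0), toPlane (t.vertex 1), toPlane (t.vertex 2)}

theorem mem_vertices_mirror {t : Tile} {x y : ℝ} :
    (x, y) ∈ t.mirror.vertices ↔ (2 - x, y) ∈ t.vertices := by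
  have h₀ : 2 - x = 0 ↔ x = 2 := by constructor <;> intro h <;> linarith
  have h₁ : 2 - x = 1 ↔ x = 1 := by constructor <;> intro h <;> linarith
  have h₂ : 2 - x = 2 ↔ x = 0 := by constructor <;> intro h <;> linarith
  cases t <;> simp [vertices, mirror, vertex, toPlane, h₀, h₁, h₂] <;> tauto

theorem Left.mem_vertices {t : Tile} {p q p' q' : ℤ} (h : t.Left p q p' q') :
    (0, (p : ℝ)) ∈ t.vertices ∧ (0, (p' : ℝ)) ∈ t.vertices ∧
    (∀ c : ℤ, q = 2 * c → (1, (c : ℝ)) ∈ t.vertices) ∧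
    (∀ c : ℤ, q' = 2 * c → (1, (c : ℝ)) ∈ t.vertices) ∧
    (∀ c : ℤ, q = 2 * c + 1 → (2, (q - p : ℝ)) ∈ t.vertices) ∧
    (∀ c : ℤ, q' = 2 * c + 1 → (2, (q' - p' : ℝ)) ∈ t.vertices) := by
  cases t <;> simp only [Left] at h <;> obtain ⟨rfl, rfl, rfl, rfl⟩ := h <;>
    simp [vertices, vertex, toPlane] <;> (try constructor) <;> intros <;> first | omega | skip
  case leftInner.left e c hc => exact Or.inr (by exact_mod_cast (by omega : c = e + 1))
  case leftInner.right => exact ⟨fun c => by omega, fun c => by omega⟩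

/-- The point `z` lies on a segment between two common vertices of `t` and `t'`. -/
def OnCommonSegment (t t' : Tile) (z : ℝ × ℝ) : Prop :=
  ∃ v ∈ t.vertices ∩ t'.vertices, ∃ w ∈ t.vertices ∩ t'.vertices, z ∈ segment ℝ v w

theorem OnCommonSegment.symm {t t' : Tile} {z : ℝ × ℝ} (h : OnCommonSegment t t' z) :
    OnCommonSegment t' t z := by
  rwa [OnCommonSegment, inter_comm]

theorem OnCommonSegment.of_mirror {t t' : Tile} {x y : ℝ}
    (h : OnCommonSegment t.mirror t'.mirror (2 - x, y)) : OnCommonSegment t t' (x, y) := by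
  obtain ⟨⟨v₁, v₂⟩, hv, ⟨w₁, w₂⟩, hw, a, b, ha, hb, hab, heq⟩ := h
  simp only [mem_inter_iff, mem_vertices_mirror] at hv hw
  refine ⟨_, hv, _, hw, a, b, ha, hb, hab, ?_⟩
  simp only [Prod.smul_mk, smul_eq_mul, Prod.mk_add_mk, Prod.mk.injEq] at heq ⊢
  exact ⟨by linear_combination 2 * hab - heq.1, heq.2⟩

theorem onCommonSegment_of_mem {t t' : Tile} {z : ℝ × ℝ} (h : z ∈ t.vertices)
    (h' : z ∈ t'.vertices) : OnCommonSegment t t' z :=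
  ⟨z, ⟨h, h'⟩, z, ⟨h, h'⟩, left_mem_segment ℝ z z⟩

theorem onCommonSegment_of_memLeft {t t' : Tile} {x y : ℝ} (hne : t ≠ t')
    (h : t.LeftOrdered t') (h' : t.mirror.LeftOrdered t'.mirror) (ht : t.MemLeft x y)
    (ht' : t'.MemLeft x y) : OnCommonSegment t t' (x, y) := by
  obtain ⟨hx, hx', p, q, p', q', hL, hy₁, hy₂⟩ := ht
  obtain ⟨-, -, r, s, r', s', hL', hy₁', hy₂'⟩ := ht'
  wlog hle : p' ≤ r ∧ q' ≤ s generalizing t t' p q p' q' r s r' s'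
  · exact (this hne.symm h.symm h'.symm r s r' s' hL' hy₁' hy₂' p q p' q' hL hy₁ hy₂
      ((h _ _ _ _ _ _ _ _ hL hL').resolve_left hle)).symm
  have heq := height_le_height hx hx' hle.1 hle.2
  have hy : y = height p' q' x := by linarith
  have hy' : y = height r s x := by linarith
  obtain ⟨-, v₁, -, v₂, -, v₃⟩ := hL.mem_vertices
  obtain ⟨w₁, -, w₂, -, w₃, -⟩ := hL'.mem_vertices
  by_cases hline : p' = r ∧ q' = s
  · obtain ⟨rfl, rfl⟩ := hline
    rcases Int.even_or_odd' q' with ⟨c, hc | hc⟩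
    · refine ⟨_, ⟨v₁, w₁⟩, _, ⟨v₂ c hc, w₂ c hc⟩, 1 - x, x, by linarith, hx, by ring, ?_⟩
      rw [hy, hc]
      simp [height]
      ring
    · refine ⟨_, ⟨v₁, w₁⟩, _, ⟨v₃ c hc, w₃ c hc⟩, 1 - x / 2, x / 2, by linarith, by linarith,
        by ring, ?_⟩
      rw [hy]
      simp [height]
      ring
  rcases hx.eq_or_lt with rfl | hx
  · obtain rfl : p' = r := by
      simp only [height] at hy hy'
      have : (p' : ℝ) = r := by linarith
      exact_mod_cast this
    obtain rfl : y = p' := by simp [hy, height]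
    exact onCommonSegment_of_mem v₁ w₁
  rcases hx'.eq_or_lt with rfl | hx'
  · obtain rfl : q' = s := by
      simp only [height] at hy hy'
      have : (q' : ℝ) = s := by linarith
      exact_mod_cast this
    rcases Int.even_or_odd' q' with ⟨c, hc | hc⟩
    · obtain rfl : y = c := by simp [hy, hc, height]
      exact onCommonSegment_of_mem (v₂ c hc) (w₂ c hc)
    · cases t <;> simp only [Left] at hL <;> try omega
      cases t' <;> simp only [Left] at hL' <;> try omega
      have := h' _ _ _ _ _ _ _ _ ⟨rfl, rfl, rfl, rfl⟩ ⟨rfl, rfl, rfl, rfl⟩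
      omega
  · exact absurd (hy.symm.trans hy') (height_lt_height hx hx' hle.1 hle.2 (by omega)).ne

theorem height_one (p q : ℤ) : height p q 1 = q / 2 := by simp [height]

theorem onCommonSegment_of_memLeft_mirror {t t' : Tile} {x y : ℝ} (hne : t ≠ t')
    (h : t.LeftOrdered t') (h' : t.mirror.LeftOrdered t'.mirror) (ht : t.MemLeft x y)
    (ht' : t'.mirror.MemLeft (2 - x) y) : OnCommonSegment t t' (x, y) := by
  obtain rfl : x = 1 := le_antisymm ht.2.1 (by linarith [ht'.2.1])
  have hne' : t.mirror ≠ t'.mirror := fun e => hne (by rw [← mirror_mirror t, e, mirror_mirror])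
  have right (ht : t.mirror.MemLeft 1 y) : OnCommonSegment t t' (1, y) := by
    refine .of_mirror ?_
    norm_num at ht' ⊢
    exact onCommonSegment_of_memLeft hne' h' (by simpa using h) ht ht'
  have left (ht' : t'.MemLeft 1 y) : OnCommonSegment t t' (1, y) :=
    onCommonSegment_of_memLeft hne h h' ht ht'
  norm_num at ht'
  obtain ⟨-, -, p, q, p', q', hL, h₁, h₂⟩ := id ht
  obtain ⟨-, -, r, s, r', s', hL', h₁', h₂'⟩ := id ht'
  rw [height_one] at h₁ h₂ h₁' h₂'
  cases t' <;> simp only [mirror, Left] at hL' <;> obtain ⟨rfl, rfl, rfl, rfl⟩ := hL'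
  case peak | valley =>
    exact left ⟨zero_le_one, le_rfl, _, _, _, _, ⟨rfl, rfl, rfl, rfl⟩, by rwa [height_one],
      by rwa [height_one]⟩
  all_goals
    cases t <;> simp only [Left] at hL <;> obtain ⟨rfl, rfl, rfl, rfl⟩ := hL
    case peak | valley =>
      exact right ⟨zero_le_one, le_rfl, _, _, _, _, ⟨rfl, rfl, rfl, rfl⟩, by rwa [height_one],
        by rwa [height_one]⟩
  all_goals
    clear hne h h' ht ht' hne' left right
    push_cast at h₁ h₂ h₁' h₂'
  case rightOuter.leftOuter c' c =>
    obtain rfl : y = c := by linarith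
    have h : (c : ℝ) = c' := by linarith
    refine onCommonSegment_of_mem ?_ ?_ <;> simp [vertices, vertex, toPlane, h]
  case rightOuter.leftInner c' c =>
    obtain rfl : y = c' := by linarith
    have h : c ≤ c' := by exact_mod_cast (by linarith : (c : ℝ) ≤ c')
    have h' : c' ≤ c + 1 := by exact_mod_cast (by linarith : (c' : ℝ) ≤ c + 1)
    obtain rfl | rfl : c' = c ∨ c' = c + 1 := by omega
    all_goals refine onCommonSegment_of_mem ?_ ?_ <;> simp [vertices, vertex, toPlane]
  case rightInner.leftOuter c' c =>
    obtain rfl : y = c := by linarith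
    have h : c' ≤ c := by exact_mod_cast (by linarith : (c' : ℝ) ≤ c)
    have h' : c ≤ c' + 1 := by exact_mod_cast (by linarith : (c : ℝ) ≤ c' + 1)
    obtain rfl | rfl : c = c' ∨ c = c' + 1 := by omega
    all_goals refine onCommonSegment_of_mem ?_ ?_ <;> simp [vertices, vertex, toPlane]
  case rightInner.leftInner c' c =>
    have h : c ≤ c' + 1 := by exact_mod_cast (by linarith : (c : ℝ) ≤ c' + 1)
    have h' : c' ≤ c + 1 := by exact_mod_cast (by linarith : (c' : ℝ) ≤ c + 1)
    obtain rfl | rfl | rfl : c = c' ∨ c = c' + 1 ∨ c' = c + 1 := by omega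
    · refine ⟨(1, c), ?_, (1, c + 1), ?_, c + 1 - y, y - c, by linarith, by linarith, by ring, ?_⟩
      · simp [vertices, vertex, toPlane]
      · simp [vertices, vertex, toPlane]
      · simp
        ring
    · obtain rfl : y = c' + 1 := by push_cast at h₁; linarith
      refine onCommonSegment_of_mem ?_ ?_ <;> simp [vertices, vertex, toPlane]
    · obtain rfl : y = c + 1 := by push_cast at h₁'; linarith
      refine onCommonSegment_of_mem ?_ ?_ <;> simp [vertices, vertex, toPlane]

theorem onCommonSegment_of_mem_toSet {t t' : Tile} {z : ℝ × ℝ} (hne : t ≠ t')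
    (h : t.LeftOrdered t') (h' : t.mirror.LeftOrdered t'.mirror) (ht : z ∈ t.toSet)
    (ht' : z ∈ t'.toSet) : OnCommonSegment t t' z := by
  obtain ⟨x, y⟩ := z
  have hne' : t.mirror ≠ t'.mirror := fun e => hne (by rw [← mirror_mirror t, e, mirror_mirror])
  rcases mem_toSet.1 ht with ht | ht <;> rcases mem_toSet.1 ht' with ht' | ht'
  · exact onCommonSegment_of_memLeft hne h h' ht ht'
  · exact onCommonSegment_of_memLeft_mirror hne h h' ht ht'
  · exact (onCommonSegment_of_memLeft_mirror hne.symm h.symm h'.symm ht' ht).symm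
  · exact .of_mirror (onCommonSegment_of_memLeft hne' h' (by simpa using h) ht ht')

theorem isFaceOf_inter {t t' : Tile} (h : t ≠ t' → t.LeftOrdered t')
    (h' : t ≠ t' → t.mirror.LeftOrdered t'.mirror) : IsFaceOf (t.toSet ∩ t'.toSet) t.toSet := by
  rcases eq_or_ne t t' with rfl | hne
  · rw [inter_self]
    exact ⟨_, _, _, t.affineIndependent_vertex, rfl, by simp⟩
  refine isFaceOf_of_segments t.affineIndependent_vertex (convex_convexHull ℝ _) fun z hz => ?_
  obtain ⟨v, hv, w, hw, hz'⟩ := onCommonSegment_of_mem_toSet hne (h hne) (h' hne) hz.1 hz.2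
  exact ⟨v, w, hv.1, hw.1, subset_convexHull ℝ _ hv.2, subset_convexHull ℝ _ hw.2, hz'⟩

end Tile

/-- The width-2 trapezoid with vertical sides of lengths `A` and `B`. -/
def trapezoid (A B : ℕ) : Set (ℝ × ℝ) :=
  {z | 0 ≤ z.1 ∧ z.1 ≤ 2 ∧ 0 ≤ z.2 ∧ 2 * z.2 ≤ A * (2 - z.1) + B * z.1}

theorem convexHull_eq_trapezoid (A B : ℕ) :
    convexHull ℝ {((0 : ℝ), (0 : ℝ)), (2, 0), (0, (A : ℝ)), (2, (B : ℝ))} = trapezoid A B := by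
  refine Subset.antisymm (convexHull_min ?_ ?_) ?_
  · rintro z (rfl | rfl | rfl | rfl) <;> norm_num [trapezoid, mul_comm]
  · rintro ⟨x, y⟩ ⟨h₁, h₂, h₃, h₄⟩ ⟨x', y'⟩ ⟨h₁', h₂', h₃', h₄'⟩ a b ha hb hab
    obtain rfl : a = 1 - b := by linarith
    simp only at h₁ h₂ h₃ h₄ h₁' h₂' h₃' h₄'
    refine ⟨?_, ?_, ?_, ?_⟩ <;> simp only [Prod.smul_mk, smul_eq_mul, Prod.mk_add_mk]
    · positivity
    · nlinarith
    · positivity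
    · nlinarith [mul_le_mul_of_nonneg_left h₄ ha, mul_le_mul_of_nonneg_left h₄' hb]
  · rintro ⟨x, y⟩ ⟨h₁, h₂, h₃, h₄⟩
    simp only at h₁ h₂ h₃ h₄
    have hC := convex_convexHull ℝ
      ({((0 : ℝ), (0 : ℝ)), (2, 0), (0, (A : ℝ)), (2, (B : ℝ))} : Set (ℝ × ℝ))
    set C := convexHull ℝ ({((0 : ℝ), (0 : ℝ)), (2, 0), (0, (A : ℝ)), (2, (B : ℝ))} : Set (ℝ × ℝ))
      with hCdef
    have m₁ : ((0 : ℝ), (0 : ℝ)) ∈ C := subset_convexHull ℝ _ (by simp)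
    have m₂ : ((2 : ℝ), (0 : ℝ)) ∈ C := subset_convexHull ℝ _ (by simp)
    have m₃ : ((0 : ℝ), (A : ℝ)) ∈ C := subset_convexHull ℝ _ (by simp)
    have m₄ : ((2 : ℝ), (B : ℝ)) ∈ C := subset_convexHull ℝ _ (by simp)
    obtain ⟨l, hl, hl', hy⟩ : ∃ l : ℝ, 0 ≤ l ∧ l ≤ 1 ∧
        2 * y = l * (A * (2 - x) + B * x) := by
      rcases (h₃.trans (by linarith : y ≤ A * (2 - x) + B * x)).eq_or_lt with h | h
      · exact ⟨0, le_rfl, zero_le_one, by linarith⟩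
      · exact ⟨2 * y / (A * (2 - x) + B * x), by positivity, (div_le_one h).2 h₄,
          (div_mul_cancel₀ _ h.ne').symm⟩
    have k₁ : ((0 : ℝ), l * A) ∈ C := by
      have := hC m₁ m₃ (sub_nonneg.2 hl') hl (by ring)
      simpa using this
    have k₂ : ((2 : ℝ), l * B) ∈ C := by
      have := hC m₂ m₄ (sub_nonneg.2 hl') hl (by ring)
      simp at this
      convert this using 2
      ring
    have := hC k₁ k₂ (by linarith : 0 ≤ 1 - x / 2) (by linarith : 0 ≤ x / 2) (by ring)
    simp at this
    convert this using 2
    linarith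

theorem mem_trapezoid_symm {A B : ℕ} {x y : ℝ} :
    (2 - x, y) ∈ trapezoid B A ↔ (x, y) ∈ trapezoid A B := by
  constructor <;> rintro ⟨h₁, h₂, h₃, h₄⟩ <;> simp only at h₁ h₂ h₃ h₄ <;>
    refine ⟨?_, ?_, ?_, ?_⟩ <;> simp only <;> linarith

theorem two_mul_height (A B : ℕ) (x : ℝ) :
    2 * height A (A + B) x = A * (2 - x) + B * x := by
  simp [height]
  ring

namespace Tile

variable {t : Tile} {A B : ℕ}

theorem leftFits_of_subset_trapezoid (h : t.toSet ⊆ trapezoid A B) : t.LeftFits A (A + B) := by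
  intro p q p' q' hL
  have mem : ∀ {x y : ℝ}, 0 ≤ x → x ≤ 1 → height p q x ≤ y → y ≤ height p' q' x →
      (x, y) ∈ trapezoid A B := fun hx hx' hy hy' =>
    h (MemLeft.mem_toSet ⟨hx, hx', p, q, p', q', hL, hy, hy'⟩)
  have hle : ∀ {x : ℝ}, 0 ≤ x → x ≤ 1 → height p q x ≤ height p' q' x := fun hx hx' =>
    height_le_height hx hx' hL.le.1 hL.le.2.1
  obtain ⟨-, -, h₁, -⟩ := mem le_rfl zero_le_one le_rfl (hle le_rfl zero_le_one)
  obtain ⟨-, -, h₂, -⟩ := mem zero_le_one le_rfl le_rfl (hle zero_le_one le_rfl)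
  obtain ⟨-, -, -, h₃⟩ := mem le_rfl zero_le_one (hle le_rfl zero_le_one) le_rfl
  obtain ⟨-, -, -, h₄⟩ := mem zero_le_one le_rfl (hle zero_le_one le_rfl) le_rfl
  simp only [height] at h₁ h₂ h₃ h₄
  refine ⟨?_, ?_, ?_, ?_⟩
  · exact_mod_cast (by linarith : (0 : ℝ) ≤ p)
  · exact_mod_cast (by linarith : (0 : ℝ) ≤ q)
  · exact_mod_cast (by linarith : (p' : ℝ) ≤ A)
  · exact_mod_cast (by linarith : (q' : ℝ) ≤ A + B)

theorem MemLeft.mem_trapezoid {x y : ℝ} (h : t.MemLeft x y) (hfit : t.LeftFits A (A + B)) :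
    (x, y) ∈ trapezoid A B := by
  obtain ⟨hx, hx', p, q, p', q', hL, hy, hy'⟩ := h
  obtain ⟨h₁, h₂, h₃, h₄⟩ := hfit _ _ _ _ hL
  refine ⟨hx, by simp only; linarith, (height_nonneg hx hx' h₁ h₂).trans hy, ?_⟩
  rw [← two_mul_height]
  linarith [height_le_height hx hx' h₃ h₄]

theorem toSet_subset_trapezoid (h : t.LeftFits A (A + B)) (h' : t.mirror.LeftFits B (B + A)) :
    t.toSet ⊆ trapezoid A B := by
  rintro ⟨x, y⟩ hz
  rcases mem_toSet.1 hz with hz | hz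
  · exact hz.mem_trapezoid h
  · exact mem_trapezoid_symm.1 (hz.mem_trapezoid h')

theorem interior_inter_mirror_eq_empty {t' : Tile} (h : interior (t.toSet ∩ t'.toSet) = ∅) :
    interior (t.mirror.toSet ∩ t'.mirror.toSet) = ∅ := by
  rw [toSet_mirror, toSet_mirror, ← preimage_inter, ← reflection.preimage_interior, h,
    preimage_empty]

end Tile

theorem fillsLeft_of_tiling {A B : ℕ} {S : Set Tile} (hsub : ∀ t ∈ S, t.toSet ⊆ trapezoid A B)
    (hdisj : ∀ t ∈ S, ∀ t' ∈ S, t ≠ t' → interior (t.toSet ∩ t'.toSet) = ∅)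
    (hcover : ∀ z ∈ trapezoid A B, ∃ t ∈ S, z ∈ t.toSet) : FillsLeft A (A + B) S where
  fits t ht := leftFits_of_subset_trapezoid (hsub t ht)
  ordered t ht t' ht' hne := by
    by_contra h
    exact (interior_inter_nonempty_of_not_leftOrdered h).ne_empty (hdisj t ht t' ht' hne)
  cover x y hx hx' hy hy' := by
    have := two_mul_height A B x
    obtain ⟨t, ht, hz⟩ := hcover (x, y)
      ⟨hx.le, by simp only; linarith, hy.le, by simp only; linarith⟩
    exact ⟨t, ht, (MemLeft.of_mem_toSet hz hx').2.2⟩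

theorem FillsLeft.mem_of_isClosed {A B : ℕ} {S : Set Tile} (h : FillsLeft A (A + B) S)
    (hpos : 0 < A + B) {U : Set (ℝ × ℝ)} (hU : IsClosed U) (hsub : ∀ t ∈ S, t.toSet ⊆ U)
    {x y : ℝ} (hz : (x, y) ∈ trapezoid A B) (hx' : x ≤ 1) : (x, y) ∈ U := by
  obtain ⟨hx, -, hy, hy'⟩ := hz
  simp only at hx hy hy'
  set k := height A (A + B) (1 / 2) with hk
  have hk2 := two_mul_height A B (1 / 2)
  have hkpos : 0 < k := by
    have h₁ : (0 : ℝ) < A + B := by exact_mod_cast hpos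
    have h₂ : (0 : ℝ) ≤ A := A.cast_nonneg
    linarith
  let γ : ℝ → ℝ × ℝ := fun s => ((1 - s) * x + s / 2, (1 - s) * y + s * (k / 2))
  have hγ : Filter.Tendsto γ (nhdsWithin 0 (Ioi 0)) (nhds (x, y)) := by
    have hc : Continuous γ := by fun_prop
    have := hc.tendsto 0
    simp only [γ, sub_zero, one_mul, zero_div, zero_mul, add_zero] at this
    exact this.mono_left nhdsWithin_le_nhds
  refine hU.mem_of_tendsto hγ ?_
  filter_upwards [Ioo_mem_nhdsGT (zero_lt_one (α := ℝ))] with s hs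
  have hs' : 0 < 1 - s := sub_pos.2 hs.2
  have hs0 := hs.1
  have h₁ : 0 < (1 - s) * x + s / 2 := by positivity
  have h₂ : (1 - s) * x + s / 2 < 1 := by nlinarith
  have h₃ : 0 < (1 - s) * y + s * (k / 2) := by positivity
  have h₄ : (1 - s) * y + s * (k / 2) < height A (A + B) ((1 - s) * x + s / 2) := by
    have e := two_mul_height A B ((1 - s) * x + s / 2)
    have := mul_le_mul_of_nonneg_left hy' hs'.le
    have := mul_pos hs0 hkpos
    nlinarith
  obtain ⟨t, ht, hmem⟩ := h.cover _ _ h₁ h₂ h₃ h₄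
  exact hsub t ht (MemLeft.mem_toSet ⟨h₁.le, h₂.le, hmem⟩)

theorem isUnimodularTriangulation_iff {A B : ℕ} (hpos : 0 < A + B) {T : Set (Set (ℝ × ℝ))} :
    IsUnimodularTriangulation (trapezoid A B) T ↔
      ∃ S, Fills A (A + B) (A + B) B S ∧ toSet '' S = T := by
  constructor
  · rintro ⟨-, hT, hcover, hface⟩
    have himage : toSet '' (toSet ⁻¹' T) = T := by
      refine image_preimage_eq_of_subset fun Δ hΔ => ?_
      exact exists_toSet_eq (hT Δ hΔ).1 fun z hz => ⟨((hT Δ hΔ).2 hz).1, ((hT Δ hΔ).2 hz).2.1⟩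
    have hsub : ∀ t ∈ toSet ⁻¹' T, t.toSet ⊆ trapezoid A B := fun t ht => (hT _ ht).2
    have hdisj : ∀ t ∈ toSet ⁻¹' T, ∀ t' ∈ toSet ⁻¹' T, t ≠ t' →
        interior (t.toSet ∩ t'.toSet) = ∅ := by
      intro t ht t' ht' hne
      by_contra h
      have h' := nonempty_iff_ne_empty.2 h
      obtain ⟨f₁, f₂⟩ := hface _ ht _ ht'
      exact hne (toSet_injective
        ((f₁.eq_of_interior_nonempty h').symm.trans (f₂.eq_of_interior_nonempty h')))
    have hcov : ∀ z ∈ trapezoid A B, ∃ t ∈ toSet ⁻¹' T, z ∈ t.toSet := by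
      intro z hz
      rw [← hcover, ← himage] at hz
      obtain ⟨_, ⟨t, ht, rfl⟩, hz⟩ := hz
      exact ⟨t, ht, hz⟩
    refine ⟨toSet ⁻¹' T, ⟨fillsLeft_of_tiling hsub hdisj hcov, ?_⟩, himage⟩
    rw [add_comm (A : ℤ)]
    refine fillsLeft_of_tiling (fun t ht => ?_) (fun t ht t' ht' hne => ?_) ?_
    · rintro ⟨x, y⟩ hz
      rw [← mem_trapezoid_symm]
      exact hsub _ ht (mem_toSet_mirror.2 (by simpa using hz))
    · have := interior_inter_mirror_eq_empty (hdisj _ ht _ ht' fun e => hne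
        (by rw [← mirror_mirror t, e, mirror_mirror]))
      simpa using this
    · rintro ⟨x, y⟩ hz
      obtain ⟨t, ht, hz'⟩ := hcov (2 - x, y) (mem_trapezoid_symm.2 hz)
      exact ⟨t.mirror, by simpa using ht, mem_toSet_mirror.2 hz'⟩
  · rintro ⟨S, hS, rfl⟩
    have hfin : S.Finite := (finite_tiles_fit _ _ _ _).subset hS.subset
    obtain ⟨h, h'⟩ := hS
    rw [add_comm (A : ℤ)] at h'
    have hmirror : ∀ t ∈ S, t.mirror ∈ mirror ⁻¹' S := fun t ht => by simpa using ht
    have hsub : ∀ t ∈ S, t.toSet ⊆ trapezoid A B := fun t ht =>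
      toSet_subset_trapezoid (h.fits t ht) (h'.fits _ (hmirror t ht))
    have hclosed : IsClosed (⋃₀ (toSet '' S)) := by
      rw [sUnion_image]
      refine hfin.isClosed_biUnion fun t _ => ?_
      exact (Set.toFinite _).isClosed_convexHull ℝ
    have hface : ∀ t ∈ S, ∀ t' ∈ S, IsFaceOf (t.toSet ∩ t'.toSet) t.toSet := fun t ht t' ht' =>
      isFaceOf_inter (h.ordered t ht t' ht') fun hne =>
        h'.ordered _ (hmirror t ht) _ (hmirror t' ht') fun e => hne
          (by rw [← mirror_mirror t, e, mirror_mirror])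
    refine ⟨hfin.image _, ?_, ?_, ?_⟩
    · rintro _ ⟨t, ht, rfl⟩
      exact ⟨t.toSet_unimodular, hsub t ht⟩
    · refine Subset.antisymm (sUnion_subset ?_) ?_
      · rintro _ ⟨t, ht, rfl⟩
        exact hsub t ht
      rintro ⟨x, y⟩ hz
      have hU : ∀ t ∈ S, t.toSet ⊆ ⋃₀ (toSet '' S) := fun t ht =>
        subset_sUnion_of_mem (mem_image_of_mem _ ht)
      rcases le_total x 1 with hx | hx
      · exact h.mem_of_isClosed hpos hclosed hU hz hx
      · have := h'.mem_of_isClosed (by omega) (hclosed.preimage reflection.continuous)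
          (fun t ht => ?_) (mem_trapezoid_symm.2 hz) (by linarith)
        · have e : reflection (2 - x, y) = (x, y) := by simp [reflection]
          rwa [mem_preimage, e] at this
        · rw [← mirror_mirror t, toSet_mirror]
          exact preimage_mono (hU _ ht)
    · rintro _ ⟨t, ht, rfl⟩ _ ⟨t', ht', rfl⟩
      exact ⟨hface t ht t' ht', inter_comm t'.toSet t.toSet ▸ hface t' ht' t ht⟩

theorem g₂_eq_numWide {A B : ℕ} (hpos : 0 < A + B) : g₂ A B = numWide A B := by
  have : {T | IsUnimodularTriangulation (trapezoid A B) T} =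
      (toSet '' ·) '' {S | Fills A (A + B) (A + B) B S} := by
    ext T
    exact isUnimodularTriangulation_iff hpos
  rw [g₂, numTriangulations, convexHull_eq_trapezoid, this,
    ncard_image_of_injective _ toSet_injective.image_injective, numWide, numFillings]

/-- The recursion for `g₂` obtained by considering the highest width-2 diagonal. -/
theorem g₂_recursion (A B : ℕ) (hpar : (A + B) % 2 = 1) :
    g₂ A B = Nat.choose ((3 * A + B - 1) / 2) A * Nat.choose ((A + 3 * B - 1) / 2) B +
      ∑ a ∈ Finset.range (A + 1), ∑ b ∈ Finset.range (B + 1),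
        (if (a + b) % 2 = 1 ∧ a + b < A + B then
          g₂ a b * Nat.choose ((3 * A + B - 3 * a - b) / 2 - 1) (A - a) *
            Nat.choose ((A + 3 * B - a - 3 * b) / 2 - 1) (B - b)
        else 0) := by
  rw [g₂_eq_numWide (by omega), numWide_rec A B hpar]
  congr 1
  refine Finset.sum_congr rfl fun a _ => Finset.sum_congr rfl fun b _ => ?_
  split_ifs with h
  · rw [g₂_eq_numWide (by omega)]
  · rfl
end
end

section
/- A triangle whose three vertices lie in ℤ² has area 1/2 if and only if the only points of ℤ² contained in the triangle are its three vertices. -/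
open Set

noncomputable section

theorem mem_convexHull_triple_iff (p q r z : ℝ × ℝ) :
    z ∈ convexHull ℝ ({p, q, r} : Set (ℝ × ℝ)) ↔
      ∃ s t : ℝ, 0 ≤ s ∧ 0 ≤ t ∧ s + t ≤ 1 ∧ z = p + s • (q - p) + t • (r - p) := by
  constructor
  · rw [convexHull_insert (insert_nonempty _ _), convexHull_pair, mem_convexJoin]
    rintro ⟨x, rfl, y, ⟨a, b, ha, hb, hab, rfl⟩, c, d, hc, hd, hcd, rfl⟩
    refine ⟨d * a, d * b, by positivity, by positivity, ?_, ?_⟩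
    · rw [← mul_add, hab]
      linarith
    · obtain rfl : c = 1 - d := by linarith
      obtain rfl : a = 1 - b := by linarith
      module
  · rintro ⟨s, t, hs, ht, hst, rfl⟩
    have hmem := (convex_convexHull ℝ ({p, q, r} : Set (ℝ × ℝ))).sum_mem
      (t := Finset.univ) (w := ![1 - s - t, s, t]) (z := ![p, q, r])
      (by simp only [Finset.mem_univ, Fin.forall_fin_succ]; simp; exact ⟨by linarith, hs, ht⟩)
      (by simp [Fin.sum_univ_three]; ring)
      (fun i _ => subset_convexHull ℝ _ (by fin_cases i <;> simp))
    convert hmem using 1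
    simp only [Fin.sum_univ_three, Matrix.cons_val]
    module

theorem triDet_ne_zero_of_affineIndependent {p q r : ℝ × ℝ}
    (h : AffineIndependent ℝ ![p, q, r]) : triDet p q r ≠ 0 := by
  intro hD
  have key : ∀ x y : ℝ, x • (q - p) + y • (r - p) = 0 → x = 0 ∧ y = 0 := by
    intro x y hxy
    have hw := affineIndependent_iff.1 h Finset.univ ![-x - y, x, y]
      (by simp [Fin.sum_univ_three]; ring)
      (by
        rw [← hxy]
        simp only [Fin.sum_univ_three, Matrix.cons_val]
        module)
    exact ⟨hw 1 (Finset.mem_univ _), hw 2 (Finset.mem_univ _)⟩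
  simp only [triDet] at hD
  have h₁ := key (r.2 - p.2) (-(q.2 - p.2))
    (by ext <;> simp <;> linarith)
  have h₂ := key (-(r.1 - p.1)) (q.1 - p.1)
    (by ext <;> simp <;> linarith)
  have h₃ := key 1 0 (by ext <;> simp <;> linarith [h₁.2, h₂.2])
  exact one_ne_zero h₃.1

theorem coords_eq_of_triDet_ne_zero {p q r : ℝ × ℝ} (hD : triDet p q r ≠ 0) {s t s' t' : ℝ}
    (h : p + s • (q - p) + t • (r - p) = p + s' • (q - p) + t' • (r - p)) :
    s = s' ∧ t = t' := by
  obtain ⟨h₁, h₂⟩ := Prod.ext_iff.1 h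
  simp at h₁ h₂
  constructor <;> refine mul_right_cancel₀ hD ?_ <;> simp only [triDet]
  · linear_combination (r.2 - p.2) * h₁ - (r.1 - p.1) * h₂
  · linear_combination (q.1 - p.1) * h₂ - (q.2 - p.2) * h₁

theorem exists_coords_of_triDet_ne_zero {p q r : ℝ × ℝ} (hD : triDet p q r ≠ 0) (w : ℝ × ℝ) :
    ∃ s t : ℝ, w = s • (q - p) + t • (r - p) := by
  refine ⟨(w.1 * (r.2 - p.2) - w.2 * (r.1 - p.1)) / triDet p q r,
    ((q.1 - p.1) * w.2 - (q.2 - p.2) * w.1) / triDet p q r, ?_⟩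
  ext <;> simp <;> field_simp <;> simp only [triDet] <;> ring

namespace IsLatticePoint

theorem add {v w : ℝ × ℝ} (hv : IsLatticePoint v) (hw : IsLatticePoint w) :
    IsLatticePoint (v + w) := by
  obtain ⟨a, b, rfl⟩ := hv
  obtain ⟨c, d, rfl⟩ := hw
  exact ⟨a + c, b + d, by simp⟩

theorem sub {v w : ℝ × ℝ} (hv : IsLatticePoint v) (hw : IsLatticePoint w) :
    IsLatticePoint (v - w) := by
  obtain ⟨a, b, rfl⟩ := hv
  obtain ⟨c, d, rfl⟩ := hw
  exact ⟨a - c, b - d, by simp⟩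

theorem int_smul {v : ℝ × ℝ} (hv : IsLatticePoint v) (n : ℤ) :
    IsLatticePoint ((n : ℝ) • v) := by
  obtain ⟨a, b, rfl⟩ := hv
  exact ⟨n * a, n * b, by simp⟩

theorem exists_triDet_eq {p q r : ℝ × ℝ} (hp : IsLatticePoint p) (hq : IsLatticePoint q)
    (hr : IsLatticePoint r) : ∃ n : ℤ, triDet p q r = n := by
  obtain ⟨a, b, rfl⟩ := hp
  obtain ⟨c, d, rfl⟩ := hq
  obtain ⟨e, f, rfl⟩ := hr
  exact ⟨(c - a) * (f - b) - (d - b) * (e - a), by simp [triDet]⟩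

end IsLatticePoint

theorem exists_int_coords_of_abs_triDet_eq_one {p q r : ℝ × ℝ} (hp : IsLatticePoint p)
    (hq : IsLatticePoint q) (hr : IsLatticePoint r) (hD : |triDet p q r| = 1) {s t : ℝ}
    (hz : IsLatticePoint (p + s • (q - p) + t • (r - p))) :
    (∃ m : ℤ, s = m) ∧ ∃ n : ℤ, t = n := by
  have hs : triDet p (p + s • (q - p) + t • (r - p)) r = s * triDet p q r := by
    simp [triDet]; ring
  have ht : triDet p q (p + s • (q - p) + t • (r - p)) = t * triDet p q r := by
    simp [triDet]; ring
  obtain ⟨m, hm⟩ := hp.exists_triDet_eq hz hr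
  obtain ⟨n, hn⟩ := hp.exists_triDet_eq hq hz
  rw [hs] at hm
  rw [ht] at hn
  rcases (abs_eq one_pos.le).1 hD with h | h <;> rw [h] at hm hn
  · exact ⟨⟨m, by linarith⟩, ⟨n, by linarith⟩⟩
  · exact ⟨⟨-m, by push_cast; linarith⟩, ⟨-n, by push_cast; linarith⟩⟩

/-- The edge vectors of an empty lattice triangle span `ℤ²`. -/
theorem exists_int_coords_of_forall_eq_vertex {p q r : ℝ × ℝ} (hp : IsLatticePoint p)
    (hq : IsLatticePoint q) (hr : IsLatticePoint r) (hD : triDet p q r ≠ 0)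
    (hempty : ∀ z ∈ convexHull ℝ ({p, q, r} : Set (ℝ × ℝ)), IsLatticePoint z →
      z = p ∨ z = q ∨ z = r)
    {w : ℝ × ℝ} (hw : IsLatticePoint w) :
    ∃ m n : ℤ, w = (m : ℝ) • (q - p) + (n : ℝ) • (r - p) := by
  have vertex : ∀ s t : ℝ, 0 ≤ s → 0 ≤ t → s + t ≤ 1 →
      IsLatticePoint (p + s • (q - p) + t • (r - p)) →
      (s = 0 ∧ t = 0) ∨ (s = 1 ∧ t = 0) ∨ (s = 0 ∧ t = 1) := by
    intro s t hs ht hst hz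
    rcases hempty _ ((mem_convexHull_triple_iff ..).2 ⟨s, t, hs, ht, hst, rfl⟩) hz with h | h | h
    · exact .inl (coords_eq_of_triDet_ne_zero hD (h.trans (by module)))
    · exact .inr (.inl (coords_eq_of_triDet_ne_zero hD (h.trans (by module))))
    · exact .inr (.inr (coords_eq_of_triDet_ne_zero hD (h.trans (by module))))
  obtain ⟨s, t, rfl⟩ := exists_coords_of_triDet_ne_zero hD w
  have hfract : IsLatticePoint (Int.fract s • (q - p) + Int.fract t • (r - p)) := by
    convert (hw.sub ((hq.sub hp).int_smul ⌊s⌋)).sub ((hr.sub hp).int_smul ⌊t⌋) using 1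
    simp only [Int.fract]
    module
  have hs₀ := Int.fract_nonneg s
  have ht₀ := Int.fract_nonneg t
  have hs₁ := Int.fract_lt_one s
  have ht₁ := Int.fract_lt_one t
  have hzero : Int.fract s = 0 ∧ Int.fract t = 0 := by
    rcases le_or_gt (Int.fract s + Int.fract t) 1 with hst | hst
    · rcases vertex _ _ hs₀ ht₀ hst (by rw [add_assoc]; exact hp.add hfract) with h | h | h
      · exact h
      · linarith [h.1]
      · linarith [h.2]
    · have hz : IsLatticePoint (p + (1 - Int.fract s) • (q - p) + (1 - Int.fract t) • (r - p)) := by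
        convert (hq.add (hr.sub hp)).sub hfract using 1
        module
      rcases vertex _ _ (by linarith) (by linarith) (by linarith) hz with h | h | h <;>
        linarith [h.1, h.2]
  refine ⟨⌊s⌋, ⌊t⌋, ?_⟩
  rw [← Int.self_sub_fract s, ← Int.self_sub_fract t, hzero.1, hzero.2, sub_zero, sub_zero]

/-- A lattice triangle has area `1/2` iff the only lattice points it contains
are its three vertices. -/
theorem area_half_iff_no_interior_lattice_points (p q r : ℝ × ℝ)
    (hp : IsLatticePoint p) (hq : IsLatticePoint q) (hr : IsLatticePoint r)
    (hind : AffineIndependent ℝ ![p, q, r]) :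
    |triDet p q r| = 1 ↔
      ∀ z ∈ convexHull ℝ ({p, q, r} : Set (ℝ × ℝ)), IsLatticePoint z →
        z = p ∨ z = q ∨ z = r := by
  constructor
  · intro hD z hz hzl
    obtain ⟨s, t, hs, ht, hst, rfl⟩ := (mem_convexHull_triple_iff ..).1 hz
    obtain ⟨⟨m, rfl⟩, ⟨n, rfl⟩⟩ := exists_int_coords_of_abs_triDet_eq_one hp hq hr hD hzl
    norm_cast at hs ht hst
    obtain ⟨rfl, rfl⟩ | ⟨rfl, rfl⟩ | ⟨rfl, rfl⟩ :
        (m = 0 ∧ n = 0) ∨ (m = 1 ∧ n = 0) ∨ (m = 0 ∧ n = 1) := by omega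
    · left; simp
    · right; left; simp
    · right; right; simp
  · intro hempty
    have hspan {w : ℝ × ℝ} (hw : IsLatticePoint w) :=
      exists_int_coords_of_forall_eq_vertex hp hq hr
        (triDet_ne_zero_of_affineIndependent hind) hempty hw
    obtain ⟨i, j, h₁⟩ := hspan (w := (1, 0)) ⟨1, 0, by simp⟩
    obtain ⟨k, l, h₂⟩ := hspan (w := (0, 1)) ⟨0, 1, by simp⟩
    obtain ⟨D, hD⟩ := hp.exists_triDet_eq hq hr
    have hmul : D * (i * l - j * k) = 1 := by
      have h : triDet p q r * (i * l - j * k) = 1 := by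
        simp [Prod.ext_iff] at h₁ h₂
        obtain ⟨h₁₁, h₁₂⟩ := h₁
        obtain ⟨h₂₁, h₂₂⟩ := h₂
        simp only [triDet]
        linear_combination (-(k * (q.2 - p.2) + l * (r.2 - p.2))) * h₁₁ - h₂₂ +
          (k * (q.1 - p.1) + l * (r.1 - p.1)) * h₁₂
      rw [hD] at h
      exact_mod_cast h
    rw [hD]
    exact_mod_cast Int.isUnit_iff_abs_eq.1 (IsUnit.of_mul_eq_one _ hmul)
end
end

section
/- Let m, n ≥ 1 be integers and let T be a triangulation of the grid P_{m,n}: a finite set of triangles with vertices in P_{m,n}, whose union is the rectangle [0,m]×[0,n], such that any two triangles of T intersect in a common (possibly empty) face of both. Then T is a fine triangulation (i.e., every point of P_{m,n} is a vertex of some triangle of T) if and only if T is unimodular (i.e., every triangle of T has area 1/2). -/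
open Set

noncomputable section

/-- A point of the grid `P_{m,n} = {0,…,m} × {0,…,n}`. -/
def IsGridPoint (m n : ℕ) (p : ℝ × ℝ) : Prop :=
  ∃ a b : ℕ, a ≤ m ∧ b ≤ n ∧ p = ((a : ℝ), (b : ℝ))

/-- A triangulation of the grid `P_{m,n}`: a finite set of triangles with
vertices in the grid, whose union is `[0,m] × [0,n]`, any two of which
intersect in a common face of both. -/
def IsGridTriangulation (m n : ℕ) (T : Set (Set (ℝ × ℝ))) : Prop :=
  T.Finite ∧
  (∀ Δ ∈ T, ∃ p q r : ℝ × ℝ, IsGridPoint m n p ∧ IsGridPoint m n q ∧ IsGridPoint m n r ∧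
    AffineIndependent ℝ ![p, q, r] ∧ Δ = convexHull ℝ {p, q, r}) ∧
  ⋃₀ T = Set.Icc (0, 0) ((m : ℝ), (n : ℝ)) ∧
  ∀ Δ₁ ∈ T, ∀ Δ₂ ∈ T, IsFaceOf (Δ₁ ∩ Δ₂) Δ₁ ∧ IsFaceOf (Δ₁ ∩ Δ₂) Δ₂

/-- `p` is a vertex of the triangle `Δ`. -/
def IsVertexOf (p : ℝ × ℝ) (Δ : Set (ℝ × ℝ)) : Prop :=
  ∃ q r : ℝ × ℝ, AffineIndependent ℝ ![p, q, r] ∧ Δ = convexHull ℝ {p, q, r}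

theorem mem_convexHull_triple_iff_s5 {p q r x : ℝ × ℝ} :
    x ∈ convexHull ℝ {p, q, r} ↔ ∃ b c : ℝ, 0 ≤ b ∧ 0 ≤ c ∧ b + c ≤ 1 ∧
      x.1 = p.1 + b * (q.1 - p.1) + c * (r.1 - p.1) ∧
      x.2 = p.2 + b * (q.2 - p.2) + c * (r.2 - p.2) := by
  constructor
  · rw [← convexJoin_singleton_segment, mem_convexJoin]
    rintro ⟨_, rfl, _, ⟨s, t, hs, ht, hst, rfl⟩, s', t', hs', ht', hst', rfl⟩
    obtain rfl : s = 1 - t := by linarith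
    obtain rfl : s' = 1 - t' := by linarith
    refine ⟨t' * (1 - t), t' * t, by positivity, by positivity, by linarith, ?_, ?_⟩ <;>
      simp only [Prod.fst_add, Prod.snd_add, Prod.smul_fst, Prod.smul_snd, smul_eq_mul] <;> ring
  · rintro ⟨b, c, hb, hc, hbc, h1, h2⟩
    refine mem_convexHull_of_exists_fintype ![1 - b - c, b, c] ![p, q, r] ?_ ?_ ?_ ?_
    · simpa [Fin.forall_fin_succ, hb, hc] using by linarith
    · simp only [Fin.sum_univ_three, Matrix.cons_val]; ring
    · simp [Fin.forall_fin_succ]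
    · ext
      · simp [Fin.sum_univ_three, h1]; ring
      · simp [Fin.sum_univ_three, h2]; ring

theorem AffineIndependent.left_mem_extremePoints {p q r : ℝ × ℝ}
    (h : AffineIndependent ℝ ![p, q, r]) : p ∈ (convexHull ℝ {p, q, r}).extremePoints ℝ := by
  have hD := triDet_ne_zero_of_affineIndependent h
  refine ⟨subset_convexHull ℝ _ (by simp), ?_⟩
  rintro x hx y hy ⟨s, t, hs, ht, hst, hp⟩
  obtain ⟨b, c, hb, hc, -, hx1, hx2⟩ := mem_convexHull_triple_iff_s5.1 hx
  obtain ⟨b', c', hb', hc', -, hy1, hy2⟩ := mem_convexHull_triple_iff_s5.1 hy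
  have h1 : s * x.1 + t * y.1 = p.1 := by simpa using congrArg Prod.fst hp
  have h2 : s * x.2 + t * y.2 = p.2 := by simpa using congrArg Prod.snd hp
  rw [hx1, hy1] at h1
  rw [hx2, hy2] at h2
  obtain rfl : s = 1 - t := by linarith
  have hbb : (1 - t) * b + t * b' = 0 := by
    refine (mul_eq_zero.1 ?_).resolve_right hD
    unfold triDet
    linear_combination (r.2 - p.2) * h1 - (r.1 - p.1) * h2
  have hcc : (1 - t) * c + t * c' = 0 := by
    refine (mul_eq_zero.1 ?_).resolve_right hD
    unfold triDet
    linear_combination (q.1 - p.1) * h2 - (q.2 - p.2) * h1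
  have hb0 : b = 0 := by
    have := mul_nonneg ht.le hb'
    nlinarith
  have hc0 : c = 0 := by
    have := mul_nonneg ht.le hc'
    nlinarith
  ext
  · simp [hx1, hb0, hc0]
  · simp [hx2, hb0, hc0]

theorem AffineIndependent.extremePoints_convexHull_triple {p q r : ℝ × ℝ}
    (h : AffineIndependent ℝ ![p, q, r]) :
    (convexHull ℝ {p, q, r}).extremePoints ℝ = {p, q, r} := by
  refine extremePoints_convexHull_subset.antisymm ?_
  rintro x (rfl | rfl | rfl)
  · exact h.left_mem_extremePoints
  · rw [Set.insert_comm]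
    exact h.comm_left.left_mem_extremePoints
  · rw [Set.pair_comm, Set.insert_comm]
    exact h.comm_right.comm_left.left_mem_extremePoints

theorem IsVertexOf.mem_extremePoints {x : ℝ × ℝ} {Δ : Set (ℝ × ℝ)} (h : IsVertexOf x Δ) :
    x ∈ Δ.extremePoints ℝ := by
  obtain ⟨q, r, hI, rfl⟩ := h
  exact hI.left_mem_extremePoints

theorem AffineIndependent.isVertexOf_of_mem {p q r x : ℝ × ℝ}
    (h : AffineIndependent ℝ ![p, q, r]) (hx : x ∈ ({p, q, r} : Set (ℝ × ℝ))) :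
    IsVertexOf x (convexHull ℝ {p, q, r}) := by
  rcases hx with rfl | rfl | rfl
  · exact ⟨_, _, h, rfl⟩
  · exact ⟨_, _, h.comm_left, by rw [Set.insert_comm]⟩
  · exact ⟨_, _, h.comm_right.comm_left, by rw [Set.pair_comm, Set.insert_comm]⟩

theorem IsFaceOf.extremePoints_subset {F Δ : Set (ℝ × ℝ)} (h : IsFaceOf F Δ) :
    F.extremePoints ℝ ⊆ Δ.extremePoints ℝ := by
  obtain ⟨p, q, r, hI, rfl, hF⟩ := h
  rcases hF with rfl | rfl | rfl | rfl | rfl | rfl | rfl | rfl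
  · simp
  · simp [hI.extremePoints_convexHull_triple]
  · simp [hI.extremePoints_convexHull_triple]
  · simp [hI.extremePoints_convexHull_triple]
  · rw [hI.extremePoints_convexHull_triple, ← convexHull_pair]
    exact extremePoints_convexHull_subset.trans (by simp [Set.insert_subset_iff])
  · rw [hI.extremePoints_convexHull_triple, ← convexHull_pair]
    exact extremePoints_convexHull_subset.trans (by simp)
  · rw [hI.extremePoints_convexHull_triple, ← convexHull_pair]
    exact extremePoints_convexHull_subset.trans (by grind)
  · exact subset_rfl

theorem IsGridPoint.isLatticePoint {m n : ℕ} {p : ℝ × ℝ} (h : IsGridPoint m n p) :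
    IsLatticePoint p := by
  obtain ⟨a, b, -, -, rfl⟩ := h
  exact ⟨a, b, by simp⟩

theorem isGridPoint_iff {m n : ℕ} {p : ℝ × ℝ} :
    IsGridPoint m n p ↔ IsLatticePoint p ∧ p ∈ Set.Icc ((0, 0) : ℝ × ℝ) ((m : ℝ), (n : ℝ)) := by
  constructor
  · intro h
    refine ⟨h.isLatticePoint, ?_⟩
    obtain ⟨a, b, ha, hb, rfl⟩ := h
    simp [Prod.le_def, ha, hb]
  · rintro ⟨⟨a, b, rfl⟩, h⟩
    simp only [Set.mem_Icc, Prod.mk_le_mk] at h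
    obtain ⟨⟨ha, hb⟩, ham, hbn⟩ := h
    lift a to ℕ using by exact_mod_cast ha
    lift b to ℕ using by exact_mod_cast hb
    exact ⟨a, b, by exact_mod_cast ham, by exact_mod_cast hbn, by simp⟩

/-- A lattice point of a unimodular lattice triangle is one of its vertices. -/
theorem IsLatticePoint.mem_triple_of_abs_triDet_eq_one {p q r x : ℝ × ℝ} (hp : IsLatticePoint p)
    (hq : IsLatticePoint q) (hr : IsLatticePoint r) (hx : IsLatticePoint x)
    (hD : |triDet p q r| = 1) (hmem : x ∈ convexHull ℝ {p, q, r}) :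
    x ∈ ({p, q, r} : Set (ℝ × ℝ)) := by
  obtain ⟨b, c, hb, hc, hbc, h1, h2⟩ := mem_convexHull_triple_iff_s5.1 hmem
  have hD2 : triDet p q r * triDet p q r = 1 := by
    rw [← abs_mul_abs_self, hD, one_mul]
  have hbD : b = triDet p q r * triDet p x r := by
    have : triDet p x r = b * triDet p q r := by
      unfold triDet; rw [h1, h2]; ring
    rw [this]; linear_combination -b * hD2
  have hcD : c = triDet p q r * triDet p q x := by
    have : triDet p q x = c * triDet p q r := by
      unfold triDet; rw [h1, h2]; ring
    rw [this]; linear_combination -c * hD2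
  have hint : ∀ y z : ℝ × ℝ, IsLatticePoint y → IsLatticePoint z →
      ∃ k : ℤ, triDet p y z = k := by
    obtain ⟨p1, p2, rfl⟩ := hp
    rintro _ _ ⟨y1, y2, rfl⟩ ⟨z1, z2, rfl⟩
    exact ⟨(y1 - p1) * (z2 - p2) - (y2 - p2) * (z1 - p1), by simp [triDet]⟩
  obtain ⟨d, hd⟩ := hint q r hq hr
  obtain ⟨k, hk⟩ := hint x r hx hr
  obtain ⟨l, hl⟩ := hint q x hq hx
  obtain ⟨i, rfl⟩ : ∃ i : ℤ, b = i := ⟨d * k, by rw [hbD, hd, hk]; simp⟩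
  obtain ⟨j, rfl⟩ : ∃ j : ℤ, c = j := ⟨d * l, by rw [hcD, hd, hl]; simp⟩
  norm_cast at hb hc hbc
  have hij : (i = 0 ∧ j = 0) ∨ (i = 1 ∧ j = 0) ∨ (i = 0 ∧ j = 1) := by omega
  rcases hij with ⟨rfl, rfl⟩ | ⟨rfl, rfl⟩ | ⟨rfl, rfl⟩
  · exact Or.inl (Prod.ext (by simp [h1]) (by simp [h2]))
  · exact Or.inr (Or.inl (Prod.ext (by simp [h1]) (by simp [h2])))
  · exact Or.inr (Or.inr (Prod.ext (by simp [h1]) (by simp [h2])))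

/-- If the integer vectors `(u₁, u₂)` and `(v₁, v₂)` do not generate `ℤ²`, then the Cramer
coefficients of some integer vector are not all divisible by the determinant. -/
theorem exists_not_dvd_cramer {u₁ u₂ v₁ v₂ : ℤ} (hD : u₁ * v₂ - u₂ * v₁ ≠ 0)
    (hD1 : ¬ IsUnit (u₁ * v₂ - u₂ * v₁)) :
    ∃ w₁ w₂ : ℤ, ¬ (u₁ * v₂ - u₂ * v₁ ∣ w₁ * v₂ - w₂ * v₁ ∧
      u₁ * v₂ - u₂ * v₁ ∣ u₁ * w₂ - u₂ * w₁) := by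
  by_contra! h
  obtain ⟨⟨a, ha⟩, ⟨b, hb⟩⟩ := h 1 0
  obtain ⟨⟨c, hc⟩, ⟨d, hd⟩⟩ := h 0 1
  set D := u₁ * v₂ - u₂ * v₁ with hDdef
  refine hD1 (IsUnit.of_mul_eq_one (a * d - b * c) (mul_left_cancel₀ hD ?_))
  have : D * (D * (a * d - b * c)) = (D * a) * (D * d) - (D * b) * (D * c) := by ring
  rw [this, ← ha, ← hb, ← hc, ← hd, hDdef]
  ring

theorem exists_lattice_combination {u₁ u₂ v₁ v₂ : ℤ} (hD : u₁ * v₂ - u₂ * v₁ ≠ 0)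
    (hD1 : ¬ IsUnit (u₁ * v₂ - u₂ * v₁)) :
    ∃ (b c : ℝ) (w₁ w₂ : ℤ), 0 ≤ b ∧ 0 ≤ c ∧ b + c ≤ 1 ∧ b < 1 ∧ c < 1 ∧ (b ≠ 0 ∨ c ≠ 0) ∧
      w₁ = b * u₁ + c * v₁ ∧ w₂ = b * u₂ + c * v₂ := by
  obtain ⟨w₁, w₂, hw⟩ := exists_not_dvd_cramer hD hD1
  set D := u₁ * v₂ - u₂ * v₁ with hDdef
  have hDR : (D : ℝ) ≠ 0 := by exact_mod_cast hD
  set β : ℝ := ((w₁ * v₂ - w₂ * v₁ : ℤ) : ℝ) / D with hβ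
  set γ : ℝ := ((u₁ * w₂ - u₂ * w₁ : ℤ) : ℝ) / D with hγ
  have h1 : (w₁ : ℝ) = β * u₁ + γ * v₁ := by
    rw [hβ, hγ]; field_simp; rw [hDdef]; push_cast; ring
  have h2 : (w₂ : ℝ) = β * u₂ + γ * v₂ := by
    rw [hβ, hγ]; field_simp; rw [hDdef]; push_cast; ring
  have hfloor : ∀ k : ℤ, Int.fract ((k : ℝ) / D) = 0 → D ∣ k := by
    intro k hk
    refine ⟨⌊(k : ℝ) / D⌋, ?_⟩
    have := Int.floor_add_fract ((k : ℝ) / D)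
    rw [hk, add_zero, eq_div_iff hDR] at this
    rw [mul_comm]
    exact_mod_cast this.symm
  have hne : Int.fract β ≠ 0 ∨ Int.fract γ ≠ 0 := by
    by_contra! h
    exact hw ⟨hfloor _ h.1, hfloor _ h.2⟩
  have e1 : ((w₁ - ⌊β⌋ * u₁ - ⌊γ⌋ * v₁ : ℤ) : ℝ) = Int.fract β * u₁ + Int.fract γ * v₁ := by
    push_cast; rw [h1, Int.fract, Int.fract]; ring
  have e2 : ((w₂ - ⌊β⌋ * u₂ - ⌊γ⌋ * v₂ : ℤ) : ℝ) = Int.fract β * u₂ + Int.fract γ * v₂ := by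
    push_cast; rw [h2, Int.fract, Int.fract]; ring
  have hβ0 := Int.fract_nonneg β
  have hγ0 := Int.fract_nonneg γ
  have hβ1 := Int.fract_lt_one β
  have hγ1 := Int.fract_lt_one γ
  rcases le_or_gt (Int.fract β + Int.fract γ) 1 with hle | hlt
  · exact ⟨_, _, _, _, hβ0, hγ0, hle, hβ1, hγ1, hne, e1, e2⟩
  · refine ⟨1 - Int.fract β, 1 - Int.fract γ, u₁ + v₁ - (w₁ - ⌊β⌋ * u₁ - ⌊γ⌋ * v₁),
      u₂ + v₂ - (w₂ - ⌊β⌋ * u₂ - ⌊γ⌋ * v₂), by linarith, by linarith, by linarith, by linarith,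
      by linarith, Or.inl (by linarith), ?_, ?_⟩
    · rw [Int.cast_sub, e1]; push_cast; ring
    · rw [Int.cast_sub, e2]; push_cast; ring

/-- A lattice triangle whose only lattice points are its vertices has area `1/2`. -/
theorem abs_triDet_eq_one_of_forall_isLatticePoint {p q r : ℝ × ℝ} (hp : IsLatticePoint p)
    (hq : IsLatticePoint q) (hr : IsLatticePoint r) (hD : triDet p q r ≠ 0)
    (h : ∀ x ∈ convexHull ℝ {p, q, r}, IsLatticePoint x → x ∈ ({p, q, r} : Set (ℝ × ℝ))) :
    |triDet p q r| = 1 := by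
  obtain ⟨p1, p2, rfl⟩ := hp
  obtain ⟨q1, q2, rfl⟩ := hq
  obtain ⟨r1, r2, rfl⟩ := hr
  have hcast : triDet ((p1 : ℝ), (p2 : ℝ)) (q1, q2) (r1, r2) =
      (((q1 - p1) * (r2 - p2) - (q2 - p2) * (r1 - p1) : ℤ) : ℝ) := by simp [triDet]
  have hDZ : (q1 - p1) * (r2 - p2) - (q2 - p2) * (r1 - p1) ≠ 0 := by
    rw [hcast] at hD
    exact_mod_cast hD
  by_contra hne
  have hunit : ¬ IsUnit ((q1 - p1) * (r2 - p2) - (q2 - p2) * (r1 - p1)) := by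
    intro hu
    rw [Int.isUnit_iff_abs_eq] at hu
    rw [hcast, ← Int.cast_abs, hu] at hne
    simp at hne
  obtain ⟨b, c, w₁, w₂, hb, hc, hbc, hb1, hc1, hbc0, e1, e2⟩ :=
    exists_lattice_combination hDZ hunit
  push_cast at e1 e2
  have hcoef : ∀ b' c' : ℝ, (b - b') * ((q1 : ℝ) - p1) + (c - c') * ((r1 : ℝ) - p1) = 0 →
      (b - b') * ((q2 : ℝ) - p2) + (c - c') * ((r2 : ℝ) - p2) = 0 → b = b' ∧ c = c' := by
    intro b' c' h1 h2
    constructor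
    · refine sub_eq_zero.1 ((mul_eq_zero.1 ?_).resolve_right hD)
      unfold triDet
      linear_combination ((r2 : ℝ) - p2) * h1 - ((r1 : ℝ) - p1) * h2
    · refine sub_eq_zero.1 ((mul_eq_zero.1 ?_).resolve_right hD)
      unfold triDet
      linear_combination ((q1 : ℝ) - p1) * h2 - ((q2 : ℝ) - p2) * h1
  have hmem := h ((p1 : ℝ) + w₁, (p2 : ℝ) + w₂)
    (mem_convexHull_triple_iff_s5.2 ⟨b, c, hb, hc, hbc, by simp only [e1]; ring,
      by simp only [e2]; ring⟩)
    ⟨p1 + w₁, p2 + w₂, by simp⟩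
  simp only [Set.mem_insert_iff, Set.mem_singleton_iff, Prod.mk.injEq] at hmem
  rcases hmem with ⟨h1, h2⟩ | ⟨h1, h2⟩ | ⟨h1, h2⟩
  · obtain ⟨hb0, hc0⟩ := hcoef 0 0 (by linarith) (by linarith)
    exact hbc0.elim (fun h => h hb0) (fun h => h hc0)
  · exact hb1.ne (hcoef 1 0 (by linarith) (by linarith)).1
  · exact hc1.ne (hcoef 0 1 (by linarith) (by linarith)).2

/-- A triangulation of the grid `P_{m,n}` is fine (every grid point is a vertex
of some triangle) iff it is unimodular (every triangle has area `1/2`). -/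
theorem fine_iff_unimodular (m n : ℕ) (hm : 1 ≤ m) (hn : 1 ≤ n)
    (T : Set (Set (ℝ × ℝ))) (hT : IsGridTriangulation m n T) :
    (∀ p : ℝ × ℝ, IsGridPoint m n p → ∃ Δ ∈ T, IsVertexOf p Δ) ↔
      (∀ Δ ∈ T, ∃ p q r : ℝ × ℝ, AffineIndependent ℝ ![p, q, r] ∧
        Δ = convexHull ℝ {p, q, r} ∧ |triDet p q r| = 1) := by
  obtain ⟨-, hvert, hcover, hface⟩ := hT
  have hsub : ∀ Δ ∈ T, Δ ⊆ Set.Icc ((0, 0) : ℝ × ℝ) ((m : ℝ), (n : ℝ)) := fun Δ hΔ =>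
    hcover ▸ Set.subset_sUnion_of_mem hΔ
  constructor
  · intro hfine Δ hΔ
    obtain ⟨p, q, r, hp, hq, hr, hI, hΔeq⟩ := hvert Δ hΔ
    refine ⟨p, q, r, hI, hΔeq, ?_⟩
    refine abs_triDet_eq_one_of_forall_isLatticePoint hp.isLatticePoint hq.isLatticePoint
      hr.isLatticePoint (triDet_ne_zero_of_affineIndependent hI) fun x hx hxl => ?_
    rw [← hΔeq] at hx
    obtain ⟨Δ', hΔ', hxv⟩ := hfine x (isGridPoint_iff.2 ⟨hxl, hsub Δ hΔ hx⟩)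
    have hxe := hxv.mem_extremePoints
    have hxi : x ∈ (Δ ∩ Δ').extremePoints ℝ :=
      inter_extremePoints_subset_extremePoints_of_subset Set.inter_subset_right
        ⟨⟨hx, hxe.1⟩, hxe⟩
    have := (hface Δ hΔ Δ' hΔ').1.extremePoints_subset hxi
    rwa [hΔeq, hI.extremePoints_convexHull_triple] at this
  · intro huni x hx
    have hxP := (isGridPoint_iff.1 hx).2
    rw [← hcover] at hxP
    obtain ⟨Δ, hΔ, hxΔ⟩ := hxP
    refine ⟨Δ, hΔ, ?_⟩
    obtain ⟨p, q, r, hI, rfl, hD⟩ := huni Δ hΔ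
    obtain ⟨p', q', r', hp', hq', hr', hI', heq⟩ := hvert _ hΔ
    have hset : ({p, q, r} : Set (ℝ × ℝ)) = {p', q', r'} := by
      rw [← hI.extremePoints_convexHull_triple, heq, hI'.extremePoints_convexHull_triple]
    have hlat : ∀ y ∈ ({p, q, r} : Set (ℝ × ℝ)), IsLatticePoint y := by
      rw [hset]
      rintro y (rfl | rfl | rfl)
      exacts [hp'.isLatticePoint, hq'.isLatticePoint, hr'.isLatticePoint]
    exact hI.isVertexOf_of_mem ((hlat p (by simp)).mem_triple_of_abs_triDet_eq_one
      (hlat q (by simp)) (hlat r (by simp)) hx.isLatticePoint hD hxΔ)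
end
end
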